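/- arXiv:1809.08679 — 5 statements merged into one kernel-verified Lean document; each statement's English description precedes it below -/
import Mathlib

section
/- Maximum principle, degenerate case k>1, subcritical gradient power (Theorem 2.6(a)): Suppose H satisfies Conditions A–C with k₁ > 0 (so k > 1 and γ > 2) and Λ^sup < ∞. Let h : ℝⁿ → ℝ be continuous with sup_{ℝⁿ} h < ∞, let m ∈ ℝ, let Z : [m,∞) → [0,∞) be continuous and non-increasing, let χ : (0,T) → ℝ be bounded and continuous, and let 0 ≤ σ ≤ γ/2. Let u be upper semicontinuous on ℝⁿ × [0,T) with inf u > m, a viscosity subsolution of H(Du, D²u + Z(u)Du⊗Du) + χ(t)|Du|^σ − u_t = 0 in ℝⁿ_T, with u(x,0) ≤ h(x) for all x ∈ ℝⁿ. If sup_{B^R_T} u = o(R^{γ*}) as R → ∞, then: if σ = 0, u(x,t) ≤ sup_{ℝⁿ} h + t·sup_{(0,T)}|χ(t)| for all (x,t) ∈ ℝⁿ_T; and if 0 < σ ≤ γ/2, u(x,t) ≤ sup_{ℝⁿ} h for all (x,t) ∈ ℝⁿ_T. -/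
open Set MeasureTheory

noncomputable section

/-- The rank-one matrix `q ⊗ q`. -/
def outerProd {n : ℕ} (q : EuclideanSpace ℝ (Fin n)) : Matrix (Fin n) (Fin n) ℝ :=
  Matrix.of fun i j => q i * q j

/-- The Loewner partial order on real matrices: `X ≤ Y` iff `Y - X` is positive semidefinite. -/
def LoewnerLE {n : ℕ} (X Y : Matrix (Fin n) (Fin n) ℝ) : Prop := (Y - X).PosSemidef

/-- Conditions A (monotonicity), B (homogeneity) and C (growth at infinity) on `H`. -/
structure ConditionsABC (n : ℕ)
    (H : EuclideanSpace ℝ (Fin n) → Matrix (Fin n) (Fin n) ℝ → ℝ) (k₁ : ℝ) : Prop where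
  continuous : Continuous fun p : EuclideanSpace ℝ (Fin n) × Matrix (Fin n) (Fin n) ℝ => H p.1 p.2
  monotone : ∀ q X Y, X.IsSymm → Y.IsSymm → LoewnerLE X Y → H q X ≤ H q Y
  zero_eq : ∀ q, H q 0 = 0
  k₁_nonneg : 0 ≤ k₁
  hom_q : ∀ (θ : ℝ) (q : EuclideanSpace ℝ (Fin n)) (X), H (θ • q) X = |θ| ^ k₁ * H q X
  hom_X : ∀ (θ : ℝ), 0 < θ → ∀ q X, H q (θ • X) = θ * H q X
  max_neg : ∀ e : EuclideanSpace ℝ (Fin n), ‖e‖ = 1 → H e (-1) < 0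
  min_pos : ∀ e : EuclideanSpace ℝ (Fin n), ‖e‖ = 1 → 0 < H e 1

/-- `Λ^sup = sup_λ max_{|e|=1} H(e, λ e⊗e + I) < ∞`. -/
def LambdaSupFinite (n : ℕ)
    (H : EuclideanSpace ℝ (Fin n) → Matrix (Fin n) (Fin n) ℝ → ℝ) : Prop :=
  ∃ C : ℝ, ∀ (lam : ℝ) (e : EuclideanSpace ℝ (Fin n)), ‖e‖ = 1 →
    H e (lam • outerProd e + 1) ≤ C

/-- `Λ^inf = inf_λ min_{|e|=1} H(e, λ e⊗e - I) > -∞`. -/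
def LambdaInfFinite (n : ℕ)
    (H : EuclideanSpace ℝ (Fin n) → Matrix (Fin n) (Fin n) ℝ → ℝ) : Prop :=
  ∃ C : ℝ, ∀ (lam : ℝ) (e : EuclideanSpace ℝ (Fin n)), ‖e‖ = 1 →
    C ≤ H e (lam • outerProd e - 1)

/-- The spatial gradient of `ψ` at `x`, as a vector in `ℝⁿ`. -/
def spaceGrad {n : ℕ} (ψ : EuclideanSpace ℝ (Fin n) → ℝ) (x : EuclideanSpace ℝ (Fin n)) :
    EuclideanSpace ℝ (Fin n) :=
  (EuclideanSpace.equiv (Fin n) ℝ).symm fun i => fderiv ℝ ψ x (EuclideanSpace.single i 1)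

/-- The spatial Hessian matrix of `ψ` at `x`. -/
def spaceHess {n : ℕ} (ψ : EuclideanSpace ℝ (Fin n) → ℝ) (x : EuclideanSpace ℝ (Fin n)) :
    Matrix (Fin n) (Fin n) ℝ :=
  Matrix.of fun i j =>
    fderiv ℝ (fun y => fderiv ℝ ψ y (EuclideanSpace.single j 1)) x (EuclideanSpace.single i 1)

/-- Viscosity subsolution of `F(t, u, Du, D²u, u_t) = 0` on `Ω ⊆ ℝⁿ × ℝ`, tested against
functions `φ(x,t)` that are C² in `x` and C¹ in `t`: whenever `u - φ` has a local maximum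
at `(x₀,t₀) ∈ Ω`, one has `F(t₀, u(x₀,t₀), Dφ, D²φ, φ_t) ≥ 0` there. -/
def ParabolicSubsolution {n : ℕ}
    (F : ℝ → ℝ → EuclideanSpace ℝ (Fin n) → Matrix (Fin n) (Fin n) ℝ → ℝ → ℝ)
    (Ω : Set (EuclideanSpace ℝ (Fin n) × ℝ)) (u : EuclideanSpace ℝ (Fin n) × ℝ → ℝ) : Prop :=
  ∀ φ : EuclideanSpace ℝ (Fin n) → ℝ → ℝ,
    (∀ t, ContDiff ℝ 2 fun x => φ x t) →
    (∀ x, ContDiff ℝ 1 fun t => φ x t) →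
    ∀ x₀ t₀, (x₀, t₀) ∈ Ω →
      IsLocalMaxOn (fun p => u p - φ p.1 p.2) Ω (x₀, t₀) →
      0 ≤ F t₀ (u (x₀, t₀)) (spaceGrad (fun x => φ x t₀) x₀) (spaceHess (fun x => φ x t₀) x₀)
          (deriv (φ x₀) t₀)

/-- Viscosity supersolution of `F(t, u, Du, D²u, u_t) = 0` on `Ω ⊆ ℝⁿ × ℝ`. -/
def ParabolicSupersolution {n : ℕ}
    (F : ℝ → ℝ → EuclideanSpace ℝ (Fin n) → Matrix (Fin n) (Fin n) ℝ → ℝ → ℝ)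
    (Ω : Set (EuclideanSpace ℝ (Fin n) × ℝ)) (u : EuclideanSpace ℝ (Fin n) × ℝ → ℝ) : Prop :=
  ∀ φ : EuclideanSpace ℝ (Fin n) → ℝ → ℝ,
    (∀ t, ContDiff ℝ 2 fun x => φ x t) →
    (∀ x, ContDiff ℝ 1 fun t => φ x t) →
    ∀ x₀ t₀, (x₀, t₀) ∈ Ω →
      IsLocalMinOn (fun p => u p - φ p.1 p.2) Ω (x₀, t₀) →
      F t₀ (u (x₀, t₀)) (spaceGrad (fun x => φ x t₀) x₀) (spaceHess (fun x => φ x t₀) x₀)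
          (deriv (φ x₀) t₀) ≤ 0

/-- derivative of the barrier profile -/
lemma hasFDerivAt_profile {n : ℕ} (z x : EuclideanSpace ℝ (Fin n)) (p : ℝ) :
    HasFDerivAt (fun y : EuclideanSpace ℝ (Fin n) => (1 + ‖y - z‖ ^ 2) ^ p)
      ((p * (1 + ‖x - z‖ ^ 2) ^ (p - 1) * 2) • innerSL ℝ (x - z)) x := by
  have h1 : HasFDerivAt (fun y : EuclideanSpace ℝ (Fin n) => y - z)
      (ContinuousLinearMap.id ℝ _) x := (hasFDerivAt_id x).sub_const z
  have h2 := (h1.norm_sq.const_add 1).rpow_const (p := p) (Or.inl (by positivity))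
  refine h2.congr_fderiv ?_
  ext v
  simp
  ring

lemma profile_grad {n : ℕ} (z x : EuclideanSpace ℝ (Fin n)) (p β C : ℝ) :
    spaceGrad (fun y => C + β * (1 + ‖y - z‖ ^ 2) ^ p) x
      = (2 * p * β * (1 + ‖x - z‖ ^ 2) ^ (p - 1)) • (x - z) := by
  have h1 := ((hasFDerivAt_profile z x p).const_mul β).const_add C
  ext i
  simp only [spaceGrad]
  rw [h1.fderiv]
  simp [EuclideanSpace.inner_single_right]
  ring

lemma profile_hess {n : ℕ} (z x : EuclideanSpace ℝ (Fin n)) (p β C : ℝ) :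
    spaceHess (fun y => C + β * (1 + ‖y - z‖ ^ 2) ^ p) x
      = (2 * p * β * (1 + ‖x - z‖ ^ 2) ^ (p - 1)) • (1 : Matrix (Fin n) (Fin n) ℝ)
        + (4 * p * (p - 1) * β * (1 + ‖x - z‖ ^ 2) ^ (p - 2)) • outerProd (x - z) := by
  ext i j
  have h0 : (fun y => fderiv ℝ (fun y => C + β * (1 + ‖y - z‖ ^ 2) ^ p) y
      (EuclideanSpace.single j 1)) =
      fun y => (2 * p * β) * ((1 + ‖y - z‖ ^ 2) ^ (p - 1) * (y j - z j)) := by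
    funext y
    have h1 := ((hasFDerivAt_profile z y p).const_mul β).const_add C
    rw [h1.fderiv]
    simp [EuclideanSpace.inner_single_right]
    ring
  have h2 : HasFDerivAt (fun y : EuclideanSpace ℝ (Fin n) => y j - z j)
      (EuclideanSpace.proj j : EuclideanSpace ℝ (Fin n) →L[ℝ] ℝ) x :=
    ((EuclideanSpace.proj j : EuclideanSpace ℝ (Fin n) →L[ℝ] ℝ).hasFDerivAt).sub_const (z j)
  have h3 := ((hasFDerivAt_profile z x (p - 1)).mul h2).const_mul (2 * p * β)
  simp only [spaceHess, Matrix.of_apply]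
  rw [h0]
  erw [h3.fderiv]
  have e : p - 1 - 1 = p - 2 := by ring
  by_cases hij : i = j
  · subst hij
    simp [EuclideanSpace.inner_single_right, outerProd, e]
    ring
  · simp [EuclideanSpace.inner_single_right, outerProd, e, hij, Ne.symm hij]
    ring

lemma small_rpow (K s d : ℝ) (hs : 0 < s) (hd : 0 < d) :
    ∃ b₀ > (0 : ℝ), ∀ β, 0 < β → β ≤ b₀ → K * β ^ s ≤ d := by
  have hc : ContinuousAt (fun β : ℝ => K * β ^ s) 0 :=
    continuousAt_const.mul (Real.continuousAt_rpow_const 0 s (Or.inr hs.le))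
  have h0 : (fun β : ℝ => K * β ^ s) 0 < d := by
    simp [Real.zero_rpow hs.ne', hd]
  have h1 := hc.eventually_lt continuousAt_const h0
  obtain ⟨r, hr, hb⟩ := Metric.eventually_nhds_iff.1 h1
  refine ⟨r / 2, by positivity, fun β h1 h2 => (hb ?_).le⟩
  rw [Real.dist_eq, sub_zero, abs_of_pos h1]
  linarith

/-- the bound on the Hamiltonian along radial profiles -/
lemma H_bound {n : ℕ} {H : EuclideanSpace ℝ (Fin n) → Matrix (Fin n) (Fin n) ℝ → ℝ} {k₁ : ℝ}
    (hH : ConditionsABC n H k₁) (hk₁ : 0 < k₁) {C : ℝ}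
    (hC : ∀ (lam : ℝ) (e : EuclideanSpace ℝ (Fin n)), ‖e‖ = 1 →
      H e (lam • outerProd e + 1) ≤ C)
    (y : EuclideanSpace ℝ (Fin n)) (c d ζ : ℝ) (hc : 0 < c) :
    H (c • y) ((c • (1 : Matrix (Fin n) (Fin n) ℝ) + d • outerProd y) + ζ • outerProd (c • y))
      ≤ c * ((c * ‖y‖) ^ k₁ * C) := by
  by_cases hy : y = 0
  · subst hy
    have : c • (0 : EuclideanSpace ℝ (Fin n)) = (0 : ℝ) • 0 := by simp
    rw [this, hH.hom_q]
    simp [Real.zero_rpow hk₁.ne']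
  · have hny : 0 < ‖y‖ := norm_pos_iff.2 hy
    set e := (‖y‖)⁻¹ • y with he
    have hne : ‖e‖ = 1 := by
      rw [he, norm_smul, norm_inv, norm_norm, inv_mul_cancel₀ hny.ne']
    have hye : y = ‖y‖ • e := by
      rw [he, smul_smul, mul_inv_cancel₀ hny.ne', one_smul]
    have hmat : (c • (1 : Matrix (Fin n) (Fin n) ℝ) + d • outerProd y) + ζ • outerProd (c • y)
        = c • (((d * ‖y‖ ^ 2 + ζ * c ^ 2 * ‖y‖ ^ 2) / c) • outerProd e + 1) := by
      generalize ‖y‖ = r at *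
      rw [hye]
      ext i j
      simp [outerProd]
      field_simp
      ring
    have hq : c • y = (c * ‖y‖) • e := by
      rw [mul_smul, ← hye]
    rw [hmat, hH.hom_X c hc, hq, hH.hom_q, abs_of_pos (by positivity)]
    gcongr
    exact hC _ _ hne

lemma hasDerivAt_pen (a t : ℝ) :
    HasDerivAt (fun s : ℝ => (max (s - a) 0) ^ 2) (2 * max (t - a) 0) t := by
  rw [hasDerivAt_iff_isLittleO]
  refine Asymptotics.IsBigO.trans_isLittleO (g := fun s => ‖s - t‖ ^ 2) ?_
    (Asymptotics.isLittleO_pow_sub_sub t (m := 2) (by norm_num))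
  refine Asymptotics.IsBigO.of_bound 1 (Filter.Eventually.of_forall fun s => ?_)
  rw [one_mul, norm_pow, norm_norm, Real.norm_eq_abs, Real.norm_eq_abs, sq_abs, abs_le,
    smul_eq_mul]
  rcases le_total (s - a) 0 with h1 | h1 <;> rcases le_total (t - a) 0 with h2 | h2 <;>
    simp only [max_eq_left, max_eq_right, h1, h2] <;> constructor <;> nlinarith

lemma contDiff_pen (a : ℝ) : ContDiff ℝ 1 (fun s : ℝ => (max (s - a) 0) ^ 2) := by
  rw [contDiff_one_iff_deriv]
  refine ⟨fun t => (hasDerivAt_pen a t).differentiableAt, ?_⟩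
  have : deriv (fun s : ℝ => (max (s - a) 0) ^ 2) = fun t => 2 * max (t - a) 0 := by
    funext t; exact (hasDerivAt_pen a t).deriv
  rw [this]
  fun_prop

/-- exponents bookkeeping: the `H` term -/
lemma exp_bound_H {k₁ : ℝ} (hk₁ : 0 < k₁) (p β w r : ℝ) (hp : p = 1 / 2 + 1 / k₁)
    (hβ : 0 < β) (hw : 1 ≤ w) (hr0 : 0 ≤ r) (hr : r ^ 2 ≤ w) (C : ℝ) (hC : 0 ≤ C) :
    (2 * p * β * w ^ (p - 1)) * ((2 * p * β * w ^ (p - 1) * r) ^ k₁ * C)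
      ≤ (C * (2 * p) * (2 * p) ^ k₁) * β ^ k₁ * (β * w ^ p) := by
  have hp0 : 0 < p := by rw [hp]; positivity
  have hw0 : 0 < w := by linarith
  have hr' : r ≤ w ^ (1 / 2 : ℝ) := by
    rw [← Real.sqrt_eq_rpow]; exact Real.le_sqrt_of_sq_le hr
  have h1 : 2 * p * β * w ^ (p - 1) * r ≤ (2 * p * β) * w ^ (1 / k₁) := by
    have : w ^ (1 / k₁) = w ^ (p - 1) * w ^ (1 / 2 : ℝ) := by
      rw [← Real.rpow_add hw0]; congr 1; rw [hp]; ring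
    rw [this, ← mul_assoc]
    gcongr
  have h2 : (2 * p * β * w ^ (p - 1) * r) ^ k₁ ≤ (2 * p) ^ k₁ * β ^ k₁ * w := by
    calc _ ≤ ((2 * p * β) * w ^ (1 / k₁)) ^ k₁ := by gcongr
      _ = _ := by
        rw [Real.mul_rpow (by positivity) (by positivity), Real.mul_rpow (by positivity) hβ.le,
          ← Real.rpow_mul hw0.le, one_div, inv_mul_cancel₀ hk₁.ne', Real.rpow_one]
  have h3 : w ^ p = w ^ (p - 1) * w := by
    rw [Real.rpow_sub_one hw0.ne']; field_simp
  calc _ ≤ (2 * p * β * w ^ (p - 1)) * (((2 * p) ^ k₁ * β ^ k₁ * w) * C) := by gcongr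
    _ = _ := by rw [h3]; ring

/-- exponents bookkeeping: gradient size -/
lemma exp_bound_q {k₁ : ℝ} (hk₁ : 0 < k₁) (p β w r : ℝ) (hp : p = 1 / 2 + 1 / k₁)
    (hβ : 0 < β) (hw : 1 ≤ w) (hr : r ^ 2 ≤ w) :
    2 * p * β * w ^ (p - 1) * r ≤ (2 * p * β) * w ^ (1 / k₁) := by
  have hp0 : 0 < p := by rw [hp]; positivity
  have hw0 : 0 < w := by linarith
  have hr' : r ≤ w ^ (1 / 2 : ℝ) := by
    rw [← Real.sqrt_eq_rpow]; exact Real.le_sqrt_of_sq_le hr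
  have : w ^ (1 / k₁) = w ^ (p - 1) * w ^ (1 / 2 : ℝ) := by
    rw [← Real.rpow_add hw0]; congr 1; rw [hp]; ring
  rw [this, ← mul_assoc]
  gcongr

/-- the first-order term is small when `σ > 0` -/
lemma grad_small {k₁ : ℝ} (hk₁ : 0 < k₁) (p σ α : ℝ) (hp : p = 1 / 2 + 1 / k₁)
    (hα : 0 ≤ α) (hσ : 0 < σ) (hσγ : σ ≤ (k₁ + 2) / 2) (d : ℝ) (hd : 0 < d) :
    ∃ b₀ > (0 : ℝ), ∀ β, 0 < β → β ≤ b₀ → ∀ w q : ℝ, 1 ≤ w → 0 ≤ q →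
      q ≤ (2 * p * β) * w ^ (1 / k₁) → α * q ^ σ ≤ 0 + d * (1 + β * w ^ p) := by
  have hp0 : 0 < p := by rw [hp]; positivity
  set θ := 2 * σ / (k₁ + 2) with hθ
  have hθ0 : 0 ≤ θ := by positivity
  have hθ1 : θ ≤ 1 := by rw [hθ, div_le_one (by positivity)]; linarith
  have hs : 0 < σ - θ := by
    have : σ - θ = σ * k₁ / (k₁ + 2) := by rw [hθ]; field_simp; ring
    rw [this]; positivity
  have hpθ : 1 / k₁ * σ = p * θ := by rw [hp, hθ]; field_simp
  obtain ⟨b₀, hb₀, hb⟩ := small_rpow (α * (2 * p) ^ σ) (σ - θ) d hs hd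
  refine ⟨b₀, hb₀, fun β hβ hβb w q hw hq hqle => ?_⟩
  have hw0 : 0 < w := by linarith
  have hB : 0 < β * w ^ p := by positivity
  have h1 : q ^ σ ≤ (2 * p) ^ σ * β ^ (σ - θ) * (β * w ^ p) ^ θ := by
    calc q ^ σ ≤ ((2 * p * β) * w ^ (1 / k₁)) ^ σ := by gcongr
      _ = _ := by
        rw [Real.mul_rpow (by positivity) (by positivity), Real.mul_rpow (by positivity) hβ.le,
          ← Real.rpow_mul hw0.le, hpθ, Real.mul_rpow hβ.le (by positivity),
          ← Real.rpow_mul hw0.le, Real.rpow_sub hβ]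
        have : 0 < β ^ θ := by positivity
        field_simp
  have h2 : (β * w ^ p) ^ θ ≤ 1 + β * w ^ p := by
    rcases le_total (β * w ^ p) 1 with h | h
    · have := Real.rpow_le_one hB.le h hθ0
      linarith
    · have := Real.rpow_le_rpow_of_exponent_le h hθ1
      rw [Real.rpow_one] at this
      linarith
  calc α * q ^ σ ≤ α * ((2 * p) ^ σ * β ^ (σ - θ) * (1 + β * w ^ p)) := by
        gcongr
        exact h1.trans (by gcongr)
    _ = (α * (2 * p) ^ σ * β ^ (σ - θ)) * (1 + β * w ^ p) := by ring
    _ ≤ d * (1 + β * w ^ p) := by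
        gcongr
        exact hb β hβ hβb
    _ = _ := by ring

set_option maxHeartbeats 1000000 in
/-- The core comparison argument with an abstract bound on the first order term. -/
lemma core_bound
    (n : ℕ)
    (H : EuclideanSpace ℝ (Fin n) → Matrix (Fin n) (Fin n) ℝ → ℝ) (k₁ : ℝ)
    (hH : ConditionsABC n H k₁) (hk₁ : 0 < k₁)
    (hΛ : LambdaSupFinite n H)
    (T : ℝ) (S A α p : ℝ) (hp : p = 1 / 2 + 1 / k₁) (hA : 0 ≤ A)
    (Z : ℝ → ℝ) (χ : ℝ → ℝ) (hχ : ∀ t ∈ Ioo 0 T, |χ t| ≤ α) (σ : ℝ)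
    (hgrad : ∀ d > (0 : ℝ), ∃ b₀ > (0 : ℝ), ∀ β, 0 < β → β ≤ b₀ → ∀ w q : ℝ, 1 ≤ w → 0 ≤ q →
      q ≤ (2 * p * β) * w ^ (1 / k₁) → α * q ^ σ ≤ A + d * (1 + β * w ^ p))
    (u : EuclideanSpace ℝ (Fin n) × ℝ → ℝ)
    (husc : UpperSemicontinuousOn u (univ ×ˢ Ico 0 T))
    (hsub : ParabolicSubsolution
      (fun t r q X pt => H q (X + Z r • outerProd q) + χ t * ‖q‖ ^ σ - pt)
      (univ ×ˢ Ioo 0 T) u)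
    (hinit : ∀ x, u (x, 0) ≤ S)
    (z : EuclideanSpace ℝ (Fin n))
    (hgrow : ∀ ε > (0:ℝ), ∃ R₀ : ℝ, ∀ R ≥ R₀, ∀ (x : EuclideanSpace ℝ (Fin n)) (t : ℝ),
      ‖x - z‖ ≤ R → t ∈ Ioo 0 T → u (x, t) ≤ ε * R ^ ((k₁ + 2) / k₁))
    (x₁ : EuclideanSpace ℝ (Fin n)) (t₁ : ℝ) (ht₁ : t₁ ∈ Ioo 0 T) :
    u (x₁, t₁) ≤ S + t₁ * A := by
  by_contra hcon
  push Not at hcon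
  obtain ⟨ht₁0, ht₁T⟩ := ht₁
  have hT : 0 < T := ht₁0.trans ht₁T
  have hp0 : 0 < p := by rw [hp]; positivity
  obtain ⟨C', hC'⟩ := hΛ
  set C := max C' 0 with hCdef
  have hC0 : 0 ≤ C := le_max_right _ _
  have hC : ∀ (lam : ℝ) (e : EuclideanSpace ℝ (Fin n)), ‖e‖ = 1 →
      H e (lam • outerProd e + 1) ≤ C := fun l e he => (hC' l e he).trans (le_max_left _ _)
  set gap := u (x₁, t₁) - (S + t₁ * A) with hgap
  have hgap0 : 0 < gap := by rw [hgap]; linarith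
  -- parameters
  set η := gap / (2 * t₁) with hη
  have hη0 : 0 < η := by positivity
  have hηt : η * t₁ = gap / 2 := by rw [hη]; field_simp
  set d := min (η / 2) (1 / (4 * (1 + T))) with hd
  have hd0 : 0 < d := by rw [hd]; positivity
  have hdη : d ≤ η / 2 := min_le_left _ _
  have hdT : d * (1 + T) ≤ 1 / 4 := by
    calc d * (1 + T) ≤ (1 / (4 * (1 + T))) * (1 + T) := by
          gcongr
          exact min_le_right _ _
      _ = 1 / 4 := by field_simp
  obtain ⟨b₁, hb₁, hb₁'⟩ := small_rpow (C * (2 * p) * (2 * p) ^ k₁) k₁ d hk₁ hd0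
  obtain ⟨b₂, hb₂, hb₂'⟩ := hgrad d hd0
  set W₁ := (1 + ‖x₁ - z‖ ^ 2) ^ p with hW₁
  have hW₁0 : 0 < W₁ := by positivity
  set b := min (min b₁ b₂ / (1 + T)) (gap / (4 * (1 + T) * W₁)) with hb
  have hb0 : 0 < b := by rw [hb]; positivity
  have hbT : b * (1 + T) ≤ min b₁ b₂ := by
    rw [← le_div_iff₀ (by positivity)]; exact min_le_left _ _
  have hbW : b * (1 + T) * W₁ ≤ gap / 4 := by
    have : b ≤ gap / (4 * (1 + T) * W₁) := min_le_right _ _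
    rw [le_div_iff₀ (by positivity)] at this
    linarith
  -- radius
  obtain ⟨R₀, hR₀⟩ := hgrow (b / 2) (by positivity)
  set g := (k₁ + 2) / k₁ with hg
  have hg0 : 0 < g := by positivity
  have hgp : g = 2 * p := by rw [hg, hp]; field_simp
  obtain ⟨R, hRR₀, hRx, hR1, hRS⟩ : ∃ R, R₀ ≤ R ∧ ‖x₁ - z‖ ≤ R ∧ 1 ≤ R ∧
      -S ≤ b / 2 * R ^ g := by
    have ht : Filter.Tendsto (fun R : ℝ => b / 2 * R ^ g) Filter.atTop Filter.atTop :=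
      (tendsto_rpow_atTop hg0).const_mul_atTop (by positivity)
    exact ((Filter.eventually_ge_atTop R₀).and ((Filter.eventually_ge_atTop _).and
      ((Filter.eventually_ge_atTop 1).and (ht.eventually_ge_atTop (-S))))).exists
  have hR0 : 0 < R := by linarith
  set M := b / 2 * R ^ g with hM
  have huM : ∀ x t, ‖x - z‖ ≤ R → t ∈ Ioo 0 T → u (x, t) ≤ M := hR₀ R hRR₀
  -- time penalty
  set T₂ := (t₁ + T) / 2 with hT₂
  have hT₂1 : t₁ < T₂ := by rw [hT₂]; linarith
  have hT₂T : T₂ < T := by rw [hT₂]; linarith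
  set K := (M + |S|) / (T₂ - t₁) ^ 2 with hK
  have hM0 : 0 < M := by positivity
  have hTT : 0 < T₂ - t₁ := by linarith
  have hK0 : 0 ≤ K := by positivity
  have hKT : K * (T₂ - t₁) ^ 2 = M + |S| := by rw [hK]; field_simp
  clear_value K
  clear_value T₂ M b d η
  let φ : EuclideanSpace ℝ (Fin n) → ℝ → ℝ := fun x t =>
    (S + (A + η) * t + K * (max (t - t₁) 0) ^ 2) + (b * (1 + t)) * (1 + ‖x - z‖ ^ 2) ^ p
  have hφcont : Continuous (fun q : EuclideanSpace ℝ (Fin n) × ℝ => φ q.1 q.2) := by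
    refine Continuous.add (by fun_prop) (Continuous.mul (by fun_prop) ?_)
    exact Continuous.rpow_const (by fun_prop) (fun _ => Or.inr hp0.le)
  have hφx : ∀ t, ContDiff ℝ 2 fun x => φ x t := by
    intro t
    refine contDiff_const.add (contDiff_const.mul ?_)
    refine ContDiff.rpow_const_of_ne ?_ (fun x => by positivity)
    exact contDiff_const.add ((contDiff_id.sub contDiff_const).norm_sq ℝ)
  have hφt : ∀ x, ContDiff ℝ 1 fun t => φ x t := by
    intro x
    have h1 := contDiff_pen t₁
    refine ContDiff.add (ContDiff.add (by fun_prop) (contDiff_const.mul h1)) (by fun_prop)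
  have hφd : ∀ x t, deriv (φ x) t =
      A + η + K * (2 * max (t - t₁) 0) + b * (1 + ‖x - z‖ ^ 2) ^ p := by
    intro x t
    refine HasDerivAt.deriv ?_
    have h1 := (hasDerivAt_pen t₁ t).const_mul K
    have h2 := (((hasDerivAt_id t).const_mul (A + η)).const_add S).add h1
    have h3 := ((((hasDerivAt_id t).const_add 1).const_mul b).mul_const
      ((1 + ‖x - z‖ ^ 2) ^ p))
    exact (h2.add h3).congr_deriv (by ring)
  -- maximum
  set Q : Set (EuclideanSpace ℝ (Fin n) × ℝ) := Metric.closedBall z R ×ˢ Icc 0 T₂ with hQ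
  have hQc : IsCompact Q := (isCompact_closedBall z R).prod isCompact_Icc
  have hQmem : (x₁, t₁) ∈ Q := by
    refine ⟨?_, ht₁0.le, hT₂1.le⟩
    rw [Metric.mem_closedBall, dist_eq_norm]; exact hRx
  have hQsub : Q ⊆ univ ×ˢ Ico 0 T := by
    rintro ⟨x, t⟩ ⟨-, h1, h2⟩
    exact ⟨mem_univ _, h1, h2.trans_lt hT₂T⟩
  have husc2 : UpperSemicontinuousOn (fun q => u q - φ q.1 q.2) Q := by
    have := (husc.mono hQsub).add (hφcont.neg.continuousOn (s := Q)).upperSemicontinuousOn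
    intro q hq
    have h2 := this q hq
    simpa only [sub_eq_add_neg, Pi.neg_apply] using h2
  obtain ⟨⟨x₀, t₀⟩, hmem, hmax⟩ := husc2.exists_isMaxOn ⟨_, hQmem⟩ hQc
  have hpos1 : 0 < u (x₁, t₁) - φ x₁ t₁ := by
    have h1 : φ x₁ t₁ = S + t₁ * A + η * t₁ + b * (1 + t₁) * W₁ := by
      simp only [φ, hW₁, sub_self, max_self]; ring
    have h2 : b * (1 + t₁) * W₁ ≤ b * (1 + T) * W₁ := by gcongr
    rw [h1]
    linarith
  have hpos : 0 < u (x₀, t₀) - φ x₀ t₀ := lt_of_lt_of_le hpos1 (hmax hQmem)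
  obtain ⟨hx₀, ht₀0, ht₀T₂⟩ := hmem
  rw [Metric.mem_closedBall, dist_eq_norm] at hx₀
  simp only at ht₀0 ht₀T₂ hx₀
  set w := 1 + ‖x₀ - z‖ ^ 2 with hw
  have hw1 : 1 ≤ w := by rw [hw]; nlinarith [sq_nonneg ‖x₀ - z‖]
  have hwp : 0 < w ^ p := by positivity
  have hφ0 : φ x₀ t₀ = (S + (A + η) * t₀ + K * (max (t₀ - t₁) 0) ^ 2) + (b * (1 + t₀)) * w ^ p :=
    rfl
  have hk0 : 0 ≤ K * (max (t₀ - t₁) 0) ^ 2 := by positivity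
  have ha0 : 0 ≤ (A + η) * t₀ := by positivity
  have hbw0 : b * w ^ p ≤ b * (1 + t₀) * w ^ p := by
    have h1 : 0 ≤ b * t₀ * w ^ p := mul_nonneg (mul_nonneg hb0.le ht₀0) hwp.le
    have h2 : b * (1 + t₀) * w ^ p = b * w ^ p + b * t₀ * w ^ p := by ring
    linarith
  have hbw1 : 0 < b * w ^ p := by positivity
  -- not at the initial time
  have ht₀pos : 0 < t₀ := by
    rcases ht₀0.lt_or_eq with h | h
    · exact h
    · exfalso
      subst h
      have := hinit x₀
      linarith
  have ht₀T : t₀ < T := ht₀T₂.trans_lt hT₂T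
  have huM0 := huM x₀ t₀ hx₀ ⟨ht₀pos, ht₀T⟩
  -- not at the final time
  have ht₀lt : t₀ < T₂ := by
    rcases ht₀T₂.lt_or_eq with h | h
    · exact h
    · exfalso
      rw [h, max_eq_left hTT.le, hKT] at hφ0
      rw [h] at ha0 hbw0
      rw [h] at hpos huM0
      have := neg_abs_le S
      linarith
  -- not on the lateral boundary
  have hx₀lt : ‖x₀ - z‖ < R := by
    rcases hx₀.lt_or_eq with h | h
    · exact h
    · exfalso
      have h1 : R ^ g ≤ w ^ p := by
        rw [hgp, Real.rpow_mul hR0.le]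
        refine Real.rpow_le_rpow (by positivity) ?_ hp0.le
        rw [hw, h, Real.rpow_two]; linarith
      have h2 : b * R ^ g ≤ b * w ^ p := by gcongr
      have h3 : b * R ^ g = 2 * M := by rw [hM]; ring
      linarith
  have hloc : IsLocalMaxOn (fun q => u q - φ q.1 q.2) (univ ×ˢ Ioo 0 T) (x₀, t₀) := by
    have hn : Q ∈ nhds (x₀, t₀) := by
      refine prod_mem_nhds ?_ (Icc_mem_nhds ht₀pos ht₀lt)
      refine Filter.mem_of_superset (Metric.isOpen_ball.mem_nhds ?_) Metric.ball_subset_closedBall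
      rw [Metric.mem_ball, dist_eq_norm]; exact hx₀lt
    exact (hmax.isLocalMax hn).on _
  have hkey := hsub φ hφx hφt x₀ t₀ ⟨mem_univ _, ht₀pos, ht₀T⟩ hloc
  rw [hφd] at hkey
  have hgr := profile_grad z x₀ p (b * (1 + t₀)) (S + (A + η) * t₀ + K * (max (t₀ - t₁) 0) ^ 2)
  have hhe := profile_hess z x₀ p (b * (1 + t₀)) (S + (A + η) * t₀ + K * (max (t₀ - t₁) 0) ^ 2)
  simp only [φ] at hkey
  rw [hgr, hhe, ← hw] at hkey
  set β := b * (1 + t₀) with hβ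
  have hβ0 : 0 < β := by positivity
  have hβT : β ≤ b * (1 + T) := by rw [hβ]; gcongr
  have hβb := hβT.trans hbT
  set c := 2 * p * β * w ^ (p - 1) with hc
  have hc0 : 0 < c := by positivity
  have hr : ‖x₀ - z‖ ^ 2 ≤ w := by rw [hw]; linarith
  have hHb := H_bound hH hk₁ hC (x₀ - z) c (4 * p * (p - 1) * β * w ^ (p - 2))
    (Z (u (x₀, t₀))) hc0
  have hHb2 := exp_bound_H hk₁ p β w ‖x₀ - z‖ hp hβ0 hw1 (norm_nonneg _) hr C hC0
  have hHb3 := hb₁' β hβ0 (hβb.trans (min_le_left _ _))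
  have hnorm : ‖c • (x₀ - z)‖ = c * ‖x₀ - z‖ := by rw [norm_smul, Real.norm_of_nonneg hc0.le]
  have hq := hb₂' β hβ0 (hβb.trans (min_le_right _ _)) w ‖c • (x₀ - z)‖ hw1 (norm_nonneg _)
    (by rw [hnorm]; exact exp_bound_q hk₁ p β w _ hp hβ0 hw1 hr)
  have hχ0 : χ t₀ * ‖c • (x₀ - z)‖ ^ σ ≤ α * ‖c • (x₀ - z)‖ ^ σ := by
    gcongr
    exact (le_abs_self _).trans (hχ t₀ ⟨ht₀pos, ht₀T⟩)
  have hB : (C * (2 * p) * (2 * p) ^ k₁) * β ^ k₁ * (β * w ^ p) ≤ d * (β * w ^ p) := by gcongr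
  have hpen : 0 ≤ K * (2 * max (t₀ - t₁) 0) := by positivity
  have hfin : d * (β * w ^ p) ≤ 1 / 4 * (b * w ^ p) := by
    calc d * (β * w ^ p) ≤ d * ((b * (1 + T)) * w ^ p) := by gcongr
      _ = (d * (1 + T)) * (b * w ^ p) := by ring
      _ ≤ _ := by gcongr
  linarith

/-- **Theorem 2.6(a)** (maximum principle, `k > 1`, `0 ≤ σ ≤ γ/2`).
Here `γ = k₁ + 2 > 2`, `γ* = γ/(γ-2) = (k₁+2)/k₁`, and `α = sup_{(0,T)} |χ|`. -/
theorem maximum_principle_k_gt_one_subcritical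
    (n : ℕ) (hn : 2 ≤ n)
    (H : EuclideanSpace ℝ (Fin n) → Matrix (Fin n) (Fin n) ℝ → ℝ) (k₁ : ℝ)
    (hH : ConditionsABC n H k₁) (hk₁ : 0 < k₁)
    (hΛ : LambdaSupFinite n H)
    (T : ℝ) (hT : 0 < T)
    (h : EuclideanSpace ℝ (Fin n) → ℝ) (hhcont : Continuous h)
    (hhbdd : BddAbove (Set.range h))
    (m : ℝ) (Z : ℝ → ℝ)
    (hZcont : ContinuousOn Z (Ici m)) (hZanti : AntitoneOn Z (Ici m))
    (hZnonneg : ∀ s ∈ Ici m, 0 ≤ Z s)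
    (χ : ℝ → ℝ) (hχcont : ContinuousOn χ (Ioo 0 T))
    (hχbdd : BddAbove ((fun t => |χ t|) '' Ioo 0 T))
    (σ : ℝ) (hσ0 : 0 ≤ σ) (hσγ : σ ≤ (k₁ + 2) / 2)
    (u : EuclideanSpace ℝ (Fin n) × ℝ → ℝ)
    (husc : UpperSemicontinuousOn u (univ ×ˢ Ico 0 T))
    (hinf : ∃ c, m < c ∧ ∀ (x : EuclideanSpace ℝ (Fin n)), ∀ t ∈ Ico 0 T, c ≤ u (x, t))
    (hsub : ParabolicSubsolution
      (fun t r q X pt => H q (X + Z r • outerProd q) + χ t * ‖q‖ ^ σ - pt)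
      (univ ×ˢ Ioo 0 T) u)
    (hinit : ∀ x, u (x, 0) ≤ h x)
    (z : EuclideanSpace ℝ (Fin n))
    (hgrow : ∀ ε > (0:ℝ), ∃ R₀ : ℝ, ∀ R ≥ R₀, ∀ (x : EuclideanSpace ℝ (Fin n)) (t : ℝ),
      ‖x - z‖ ≤ R → t ∈ Ioo 0 T → u (x, t) ≤ ε * R ^ ((k₁ + 2) / k₁)) :
    (σ = 0 → ∀ (x : EuclideanSpace ℝ (Fin n)), ∀ t ∈ Ioo 0 T,
        u (x, t) ≤ (⨆ y, h y) + t * sSup ((fun s => |χ s|) '' Ioo 0 T)) ∧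
    (0 < σ → ∀ (x : EuclideanSpace ℝ (Fin n)), ∀ t ∈ Ioo 0 T,
        u (x, t) ≤ ⨆ y, h y) := by
  have hp : (1 / 2 + 1 / k₁ : ℝ) = 1 / 2 + 1 / k₁ := rfl
  have hχ : ∀ t ∈ Ioo 0 T, |χ t| ≤ sSup ((fun s => |χ s|) '' Ioo 0 T) :=
    fun t ht => le_csSup hχbdd ⟨t, ht, rfl⟩
  have hα : 0 ≤ sSup ((fun s => |χ s|) '' Ioo 0 T) :=
    (abs_nonneg _).trans (hχ (T / 2) ⟨by linarith, by linarith⟩)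
  have hinit' : ∀ x, u (x, 0) ≤ ⨆ y, h y := fun x => (hinit x).trans (le_ciSup hhbdd x)
  constructor
  · intro hσ x t ht
    refine core_bound n H k₁ hH hk₁ hΛ T _ _ _ _ hp hα Z χ hχ σ ?_ u husc hsub hinit' z hgrow
      x t ht
    intro d hd
    refine ⟨1, one_pos, fun β hβ _ w q hw _ _ => ?_⟩
    rw [hσ, Real.rpow_zero, mul_one]
    have : 0 ≤ d * (1 + β * w ^ (1 / 2 + 1 / k₁)) := by positivity
    linarith
  · intro hσ x t ht
    have := core_bound n H k₁ hH hk₁ hΛ T _ 0 _ _ hp le_rfl Z χ hχ σ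
      (grad_small hk₁ _ σ _ hp hα hσ hσγ) u husc hsub hinit' z hgrow x t ht
    simpa using this
end
end

section
/- Minimum principle, degenerate case k>1, subcritical gradient power (Theorem 2.7(a)): Suppose H satisfies Conditions A–C with k₁ > 0 (so k > 1 and γ > 2) and Λ^sup < ∞ (no assumption is made on Λ^inf). Let h : ℝⁿ → ℝ be continuous with inf_{ℝⁿ} h > −∞, let Z : (−∞,∞) → [0,∞) be continuous and non-increasing, let χ : (0,T) → ℝ be bounded and continuous, and let 0 ≤ σ ≤ γ/2. Let u be lower semicontinuous on ℝⁿ × [0,T), a viscosity supersolution of H(Du, D²u + Z(u)Du⊗Du) + χ(t)|Du|^σ − u_t = 0 in ℝⁿ_T, with u(x,0) ≥ h(x) for all x ∈ ℝⁿ. If sup_{B^R_T} (−u) = o(R^{γ*}) as R → ∞, then: if σ = 0, u(x,t) ≥ inf_{ℝⁿ} h − t·sup_{(0,T)}|χ(t)| for all (x,t) ∈ ℝⁿ_T; and if 0 < σ ≤ γ/2, u(x,t) ≥ inf_{ℝⁿ} h for all (x,t) ∈ ℝⁿ_T. -/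
open Set MeasureTheory

noncomputable section

section aux
variable {n : ℕ}

lemma aux_hasFDeriv (z x : EuclideanSpace ℝ (Fin n)) (b : ℝ) :
    HasFDerivAt (fun y : EuclideanSpace ℝ (Fin n) => (1 + ‖y - z‖ ^ 2) ^ b)
      ((b * (1 + ‖x - z‖ ^ 2) ^ (b - 1)) • ((2 : ℝ) • innerSL ℝ (x - z))) x := by
  have h1 : HasFDerivAt (fun y : EuclideanSpace ℝ (Fin n) => y - z)
      (ContinuousLinearMap.id ℝ _) x := (hasFDerivAt_id x).sub_const z
  have h2 := (h1.norm_sq).const_add 1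
  have hpos : (1 + ‖x - z‖ ^ 2) ≠ 0 := by positivity
  have h3 := h2.rpow_const (p := b) (Or.inl hpos)
  refine h3.congr_fderiv ?_
  ext v
  simp

lemma aux_contDiff (z : EuclideanSpace ℝ (Fin n)) (b : ℝ) :
    ContDiff ℝ 2 (fun y : EuclideanSpace ℝ (Fin n) => (1 + ‖y - z‖ ^ 2) ^ b) := by
  apply ContDiff.rpow_const_of_ne
  · exact contDiff_const.add ((contDiff_id.sub contDiff_const).norm_sq ℝ)
  · intro x; positivity

lemma aux_fderiv (z x : EuclideanSpace ℝ (Fin n)) (b c s : ℝ) (j : Fin n) :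
    fderiv ℝ (fun y : EuclideanSpace ℝ (Fin n) => c - s * (1 + ‖y - z‖ ^ 2) ^ b) x
      (EuclideanSpace.single j 1) =
    -(s * (2 * b) * (1 + ‖x - z‖ ^ 2) ^ (b - 1)) * (x - z) j := by
  rw [(((aux_hasFDeriv z x b).const_mul s).const_sub c).fderiv]
  simp [EuclideanSpace.inner_single_right]
  ring

lemma aux_grad (z x : EuclideanSpace ℝ (Fin n)) (b c s : ℝ) :
    spaceGrad (fun y : EuclideanSpace ℝ (Fin n) => c - s * (1 + ‖y - z‖ ^ 2) ^ b) x
     = (-(s * (2 * b) * (1 + ‖x - z‖ ^ 2) ^ (b - 1))) • (x - z) := by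
  ext j
  have : spaceGrad (fun y : EuclideanSpace ℝ (Fin n) => c - s * (1 + ‖y - z‖ ^ 2) ^ b) x j
    = fderiv ℝ (fun y : EuclideanSpace ℝ (Fin n) => c - s * (1 + ‖y - z‖ ^ 2) ^ b) x
      (EuclideanSpace.single j 1) := rfl
  rw [this, aux_fderiv]
  simp

lemma aux_hess (z x : EuclideanSpace ℝ (Fin n)) (b c s : ℝ) :
    spaceHess (fun y : EuclideanSpace ℝ (Fin n) => c - s * (1 + ‖y - z‖ ^ 2) ^ b) x
     = (-(s * (2 * b) * (1 + ‖x - z‖ ^ 2) ^ (b - 1))) • (1 : Matrix (Fin n) (Fin n) ℝ)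
      - (s * (2 * b) * (2 * (b - 1)) * (1 + ‖x - z‖ ^ 2) ^ (b - 2)) • outerProd (x - z) := by
  ext i j
  simp only [spaceHess, Matrix.of_apply, aux_fderiv]
  have h1 : HasFDerivAt (fun y : EuclideanSpace ℝ (Fin n) => (y - z) j)
      (EuclideanSpace.proj j : EuclideanSpace ℝ (Fin n) →L[ℝ] ℝ) x := by
    have := (EuclideanSpace.proj j : EuclideanSpace ℝ (Fin n) →L[ℝ] ℝ).hasFDerivAt (x := x)
    exact this.sub_const (z j)
  have h2 := ((((aux_hasFDeriv z x (b - 1)).const_mul (s * (2 * b))).neg).mul h1)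
  have h3 : fderiv ℝ (fun y : EuclideanSpace ℝ (Fin n) =>
      -(s * (2 * b) * (1 + ‖y - z‖ ^ 2) ^ (b - 1)) * (y - z) j) x = _ := h2.fderiv
  rw [h3]
  have h4 : b - 1 - 1 = b - 2 := by ring
  by_cases hij : i = j
  · subst hij
    simp [EuclideanSpace.inner_single_right, outerProd, h4]
    ring
  · have hji : ¬ j = i := fun h => hij h.symm
    simp [EuclideanSpace.inner_single_right, outerProd, h4, hij, hji, Matrix.one_apply]
    ring

lemma outerProd_isSymm (q : EuclideanSpace ℝ (Fin n)) : (outerProd q).IsSymm := by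
  ext i j; simp [outerProd, mul_comm]

lemma outerProd_quad (q : EuclideanSpace ℝ (Fin n)) (v : Fin n → ℝ) :
    v ⬝ᵥ (outerProd q).mulVec v = (∑ i, q i * v i) ^ 2 := by
  rw [pow_two, Finset.sum_mul_sum]
  simp only [dotProduct, Matrix.mulVec, outerProd, Matrix.of_apply, Finset.mul_sum]
  exact Finset.sum_congr rfl fun i _ => Finset.sum_congr rfl fun j _ => by ring

lemma outerProd_le (q : EuclideanSpace ℝ (Fin n)) (v : Fin n → ℝ) :
    (∑ i, q i * v i) ^ 2 ≤ ‖q‖ ^ 2 * ∑ i, v i ^ 2 := by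
  rw [EuclideanSpace.real_norm_sq_eq]
  exact Finset.sum_mul_sq_le_sq_mul_sq _ _ _

/-- Loewner comparison for the Hessian of the barrier. -/
lemma aux_loewner (y q : EuclideanSpace ℝ (Fin n)) (a d ζ c : ℝ) (hζ : 0 ≤ ζ)
    (hc : a + |d| * ‖y‖ ^ 2 ≤ c) :
    LoewnerLE ((-c) • (1 : Matrix (Fin n) (Fin n) ℝ))
      ((-a) • (1 : Matrix (Fin n) (Fin n) ℝ) - d • outerProd y + ζ • outerProd q) := by
  unfold LoewnerLE
  rw [Matrix.posSemidef_iff_dotProduct_mulVec]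
  constructor
  · have : ((-a) • (1 : Matrix (Fin n) (Fin n) ℝ) - d • outerProd y + ζ • outerProd q -
      (-c) • (1 : Matrix (Fin n) (Fin n) ℝ)).IsSymm := by
      refine Matrix.IsSymm.sub (Matrix.IsSymm.add (Matrix.IsSymm.sub ?_ ?_) ?_) ?_
      · exact Matrix.isSymm_one.smul _
      · exact (outerProd_isSymm _).smul _
      · exact (outerProd_isSymm _).smul _
      · exact Matrix.isSymm_one.smul _
    exact (Matrix.conjTranspose_eq_transpose_of_trivial _).trans this
  · intro v
    have e : star v = v := by ext i; simp
    rw [e]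
    simp only [Matrix.sub_mulVec, Matrix.add_mulVec, Matrix.smul_mulVec, Matrix.one_mulVec,
      dotProduct_sub, dotProduct_add, dotProduct_smul, outerProd_quad, smul_eq_mul]
    have hv : v ⬝ᵥ v = ∑ i, v i ^ 2 := by simp [dotProduct, pow_two]
    rw [hv]
    have h1 := outerProd_le y v
    have h2 : 0 ≤ ∑ i, v i ^ 2 := Finset.sum_nonneg fun i _ => sq_nonneg _
    have h3 : 0 ≤ ζ * (∑ i, q i * v i) ^ 2 := by positivity
    have h4 : d * (∑ i, y i * v i) ^ 2 ≤ |d| * (‖y‖ ^ 2 * ∑ i, v i ^ 2) :=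
      (mul_le_mul_of_nonneg_right (le_abs_self d) (sq_nonneg _)).trans
        (mul_le_mul_of_nonneg_left h1 (abs_nonneg d))
    have h5 := mul_le_mul_of_nonneg_right hc h2
    nlinarith

lemma aux_H_neg_one (H : EuclideanSpace ℝ (Fin n) → Matrix (Fin n) (Fin n) ℝ → ℝ) (k₁ : ℝ)
    (hH : ConditionsABC n H k₁) (hk₁ : 0 < k₁) :
    ∃ C : ℝ, 0 ≤ C ∧ ∀ q, -(C * ‖q‖ ^ k₁) ≤ H q (-1) := by
  have hcont : Continuous fun q => H q (-1) :=
    hH.continuous.comp (continuous_id.prodMk continuous_const)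
  obtain ⟨C, hC⟩ := (isCompact_sphere (0 : EuclideanSpace ℝ (Fin n)) 1).exists_bound_of_continuousOn
    hcont.continuousOn
  refine ⟨|C|, abs_nonneg _, fun q => ?_⟩
  by_cases hq : q = 0
  · subst hq
    have := hH.hom_q 0 0 (-1)
    simp [Real.zero_rpow hk₁.ne'] at this
    simp [Real.zero_rpow hk₁.ne', this]
  · have hq' : ‖q‖ ≠ 0 := norm_ne_zero_iff.mpr hq
    have h1 := hH.hom_q ‖q‖ (‖q‖⁻¹ • q) (-1)
    rw [smul_smul, mul_inv_cancel₀ hq', one_smul, abs_norm] at h1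
    have h2 := hC (‖q‖⁻¹ • q) (by simp [norm_smul, hq'])
    rw [Real.norm_eq_abs] at h2
    have h3 := (abs_le.mp (h2.trans (le_abs_self C))).1
    have h4 : 0 ≤ ‖q‖ ^ k₁ := by positivity
    rw [h1]
    nlinarith

/-- Lower bound of the operator on the barrier. -/
lemma aux_lower (H : EuclideanSpace ℝ (Fin n) → Matrix (Fin n) (Fin n) ℝ → ℝ) (k₁ : ℝ)
    (hH : ConditionsABC n H k₁) (hk₁ : 0 < k₁) (z : EuclideanSpace ℝ (Fin n)) :
    ∃ C : ℝ, 0 ≤ C ∧ ∀ (x : EuclideanSpace ℝ (Fin n)) (c s ζ : ℝ), 0 < s → s ≤ 1 → 0 ≤ ζ →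
      ∀ q, q = spaceGrad (fun y : EuclideanSpace ℝ (Fin n) =>
          c - s * (1 + ‖y - z‖ ^ 2) ^ ((k₁ + 2) / k₁ / 2)) x →
      ‖q‖ ≤ s * ((k₁ + 2) / k₁) * (1 + ‖x - z‖ ^ 2) ^ (1 / k₁) ∧
      -(C * s * (1 + ‖x - z‖ ^ 2) ^ ((k₁ + 2) / k₁ / 2)) ≤
        H q (spaceHess (fun y : EuclideanSpace ℝ (Fin n) =>
          c - s * (1 + ‖y - z‖ ^ 2) ^ ((k₁ + 2) / k₁ / 2)) x + ζ • outerProd q) := by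
  obtain ⟨C₁, hC₁, hC⟩ := aux_H_neg_one H k₁ hH hk₁
  set β := (k₁ + 2) / k₁ with hβ
  have hβpos : 0 < β := by positivity
  refine ⟨β * (1 + |β - 2|) * C₁ * β ^ k₁, by positivity, ?_⟩
  intro x c s ζ hs hs1 hζ q hq
  rw [aux_grad] at hq
  rw [aux_hess]
  set y := x - z with hy
  set ρ := 1 + ‖y‖ ^ 2 with hρ
  have hρ1 : 1 ≤ ρ := by have := sq_nonneg ‖y‖; linarith
  have hρ0 : 0 < ρ := by linarith
  have e2 : 2 * (β / 2) = β := by ring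
  have e3 : 2 * (β / 2 - 1) = β - 2 := by ring
  rw [e2] at hq
  rw [e2, e3]
  have hyle : ‖y‖ ≤ ρ ^ (1 / 2 : ℝ) := by
    rw [← Real.sqrt_eq_rpow]
    exact Real.le_sqrt_of_sq_le (by linarith)
  have hexp : ρ ^ (β / 2 - 1) * ρ ^ (1 / 2 : ℝ) = ρ ^ (1 / k₁) := by
    rw [← Real.rpow_add hρ0]; congr 1; rw [hβ]; field_simp; ring
  have hqn : ‖q‖ ≤ s * β * ρ ^ (1 / k₁) := by
    rw [hq, norm_smul, norm_neg, Real.norm_eq_abs, abs_of_nonneg (by positivity), ← hexp, ← mul_assoc]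
    exact mul_le_mul_of_nonneg_left hyle (by positivity)
  refine ⟨hqn, ?_⟩
  set K := s * β * (1 + |β - 2|) * ρ ^ (β / 2 - 1) with hK
  have hKpos : 0 < K := by positivity
  have hsplit : ρ ^ (β / 2 - 2) * ρ = ρ ^ (β / 2 - 1) := by
    nth_rewrite 2 [← Real.rpow_one ρ]
    rw [← Real.rpow_add hρ0]; congr 1; ring
  have hL := aux_loewner y q (s * β * ρ ^ (β / 2 - 1)) (s * β * (β - 2) * ρ ^ (β / 2 - 2)) ζ K hζ (by
    rw [abs_mul, abs_mul, abs_of_pos (by positivity : 0 < s * β),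
      abs_of_pos (by positivity : 0 < ρ ^ (β / 2 - 2))]
    have : s * β * |β - 2| * ρ ^ (β / 2 - 2) * ‖y‖ ^ 2 ≤ s * β * |β - 2| * ρ ^ (β / 2 - 2) * ρ := by
      apply mul_le_mul_of_nonneg_left (by linarith) (by positivity)
    rw [mul_assoc (s * β * |β - 2|) _ ρ, hsplit] at this
    rw [hK]
    nlinarith)
  have hmono := hH.monotone q _ _ (Matrix.isSymm_one.smul _)
    (((Matrix.isSymm_one.smul _).sub ((outerProd_isSymm _).smul _)).add
      ((outerProd_isSymm _).smul _)) hL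
  refine le_trans ?_ hmono
  have e5 : (-K) • (1 : Matrix (Fin n) (Fin n) ℝ) = K • (-1) := by simp
  rw [e5, hH.hom_X K hKpos]
  have h6 : ‖q‖ ^ k₁ ≤ s ^ k₁ * β ^ k₁ * ρ := by
    have := Real.rpow_le_rpow (norm_nonneg q) hqn hk₁.le
    rwa [Real.mul_rpow (by positivity) (by positivity), Real.mul_rpow hs.le hβpos.le,
      ← Real.rpow_mul hρ0.le, one_div, inv_mul_cancel₀ hk₁.ne', Real.rpow_one] at this
  have h7 : s ^ k₁ ≤ 1 := Real.rpow_le_one hs.le hs1 hk₁.le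
  have h8 : ‖q‖ ^ k₁ ≤ β ^ k₁ * ρ := by
    refine h6.trans ?_
    have : 0 ≤ β ^ k₁ * ρ := by positivity
    nlinarith
  have h9 : ρ ^ (β / 2 - 1) * ρ = ρ ^ (β / 2) := by
    nth_rewrite 2 [← Real.rpow_one ρ]
    rw [← Real.rpow_add hρ0]; congr 1; ring
  have h10 : K * (C₁ * ‖q‖ ^ k₁) ≤ K * (C₁ * (β ^ k₁ * ρ)) := by gcongr
  have h11 : K * (C₁ * (β ^ k₁ * ρ)) = β * (1 + |β - 2|) * C₁ * β ^ k₁ * s * ρ ^ (β / 2) := by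
    rw [← h9, hK]; ring
  have h12 := mul_le_mul_of_nonneg_left (hC q) hKpos.le
  linarith

/-- Elementary bound of the gradient term, `σ > 0`. -/
lemma aux_young (k₁ σ M η : ℝ) (hk₁ : 0 < k₁) (hσ : 0 < σ) (hσγ : σ ≤ (k₁ + 2) / 2)
    (hM : 0 ≤ M) (hη : 0 < η) :
    ∃ K : ℝ, 0 ≤ K ∧ ∀ s ρ q : ℝ, 0 < s → s ≤ 1 → 1 ≤ ρ → 0 ≤ q →
      q ≤ s * ((k₁ + 2) / k₁) * ρ ^ (1 / k₁) →
      M * q ^ σ ≤ η + K * s * ρ ^ ((k₁ + 2) / k₁ / 2) := by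
  set β := (k₁ + 2) / k₁ with hβ
  have hβpos : 0 < β := by positivity
  by_cases h1 : 1 ≤ σ
  · refine ⟨M * β ^ σ, by positivity, ?_⟩
    intro s ρ q hs hs1 hρ hq hqle
    have hρ0 : 0 < ρ := by linarith
    have h2 := Real.rpow_le_rpow hq hqle hσ.le
    rw [Real.mul_rpow (by positivity) (by positivity), Real.mul_rpow hs.le hβpos.le,
      ← Real.rpow_mul hρ0.le] at h2
    have h3 : s ^ σ ≤ s := by
      simpa using Real.rpow_le_rpow_of_exponent_ge hs hs1 h1
    have h4 : ρ ^ (1 / k₁ * σ) ≤ ρ ^ (β / 2) := by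
      apply Real.rpow_le_rpow_of_exponent_le hρ
      rw [hβ]
      have : 1 / k₁ * σ ≤ 1 / k₁ * ((k₁ + 2) / 2) := by gcongr
      refine this.trans (le_of_eq ?_)
      field_simp
    have h5 : q ^ σ ≤ s * β ^ σ * ρ ^ (β / 2) := h2.trans (by gcongr)
    have h6 := mul_le_mul_of_nonneg_left h5 hM
    nlinarith
  · push Not at h1
    set η' := η / (M + 1) with hη'
    have hη'pos : 0 < η' := by positivity
    set s0 := η' ^ (1 / σ) with hs0
    have hs0pos : 0 < s0 := by positivity
    refine ⟨M * s0 ^ (σ - 1) * β, by positivity, ?_⟩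
    intro s ρ q hs hs1 hρ hq hqle
    have hρ0 : 0 < ρ := by linarith
    have hKnn : 0 ≤ M * s0 ^ (σ - 1) * β * s * ρ ^ (β / 2) := by positivity
    by_cases hqs : q ≤ s0
    · have h2 := Real.rpow_le_rpow hq hqs hσ.le
      rw [hs0, ← Real.rpow_mul hη'pos.le, one_div, inv_mul_cancel₀ hσ.ne', Real.rpow_one] at h2
      have h3 : M * q ^ σ ≤ (M + 1) * η' := by
        have : 0 ≤ q ^ σ := by positivity
        nlinarith
      have h4 : (M + 1) * η' = η := by rw [hη']; field_simp
      linarith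
    · push Not at hqs
      have hq0 : 0 < q := hs0pos.trans hqs
      have h2 : q ^ σ = q ^ (σ - 1) * q := by
        rw [Real.rpow_sub_one hq0.ne']; field_simp
      have h3 : q ^ (σ - 1) ≤ s0 ^ (σ - 1) :=
        Real.rpow_le_rpow_of_nonpos hs0pos hqs.le (by linarith)
      have h4 : ρ ^ (1 / k₁) ≤ ρ ^ (β / 2) := by
        apply Real.rpow_le_rpow_of_exponent_le hρ
        have e : β / 2 = 1 / 2 + 1 / k₁ := by rw [hβ]; field_simp
        rw [e]; linarith
      have h5 : q ≤ s * β * ρ ^ (β / 2) := hqle.trans (by gcongr)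
      have h6 : M * q ^ σ ≤ M * (s0 ^ (σ - 1) * (s * β * ρ ^ (β / 2))) := by
        rw [h2]; gcongr
      nlinarith

lemma aux_compare
    (H : EuclideanSpace ℝ (Fin n) → Matrix (Fin n) (Fin n) ℝ → ℝ) (k₁ : ℝ)
    (hH : ConditionsABC n H k₁) (hk₁ : 0 < k₁)
    (T : ℝ)
    (Z : ℝ → ℝ) (hZnonneg : ∀ s, 0 ≤ Z s)
    (χ : ℝ → ℝ) (σ : ℝ)
    (u : EuclideanSpace ℝ (Fin n) × ℝ → ℝ)
    (hlsc : LowerSemicontinuousOn u (univ ×ˢ Ico 0 T))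
    (hsuper : ParabolicSupersolution
      (fun t r q X pt => H q (X + Z r • outerProd q) + χ t * ‖q‖ ^ σ - pt)
      (univ ×ˢ Ioo 0 T) u)
    (m : ℝ) (hinit : ∀ x, m ≤ u (x, 0))
    (z : EuclideanSpace ℝ (Fin n))
    (hgrow : ∀ ε > (0:ℝ), ∃ R₀ : ℝ, ∀ R ≥ R₀, ∀ (x : EuclideanSpace ℝ (Fin n)) (t : ℝ),
      ‖x - z‖ ≤ R → t ∈ Ioo 0 T → -u (x, t) ≤ ε * R ^ ((k₁ + 2) / k₁))
    (M η K' : ℝ) (hM : ∀ t ∈ Ioo 0 T, |χ t| ≤ M) (hη : 0 ≤ η) (hK' : 0 ≤ K')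
    (hyoung : ∀ s ρ q : ℝ, 0 < s → s ≤ 1 → 1 ≤ ρ → 0 ≤ q →
      q ≤ s * ((k₁ + 2) / k₁) * ρ ^ (1 / k₁) →
      M * q ^ σ ≤ η + K' * s * ρ ^ ((k₁ + 2) / k₁ / 2))
    (x₁ : EuclideanSpace ℝ (Fin n)) (t₁ : ℝ) (ht₁ : t₁ ∈ Ioo 0 T) :
    m - η * t₁ ≤ u (x₁, t₁) := by
  by_contra hcon
  push Not at hcon
  obtain ⟨C, hC0, hC⟩ := aux_lower H k₁ hH hk₁ z
  set β := (k₁ + 2) / k₁ with hβ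
  have hβpos : 0 < β := by positivity
  set d := m - η * t₁ - u (x₁, t₁) with hd
  have hdpos : 0 < d := by linarith
  set K := C + K' with hKdef
  have hK0 : 0 ≤ K := by positivity
  set w : EuclideanSpace ℝ (Fin n) → ℝ := fun x => (1 + ‖x - z‖ ^ 2) ^ (β / 2) with hw
  have hw1 : ∀ x, 1 ≤ w x := fun x =>
    Real.one_le_rpow (by have := sq_nonneg ‖x - z‖; linarith) (by positivity)
  have hwr : ∀ x, ‖x - z‖ ^ β ≤ w x := by
    intro x
    have : ‖x - z‖ ^ β = (‖x - z‖ ^ 2) ^ (β / 2) := by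
      rw [← Real.rpow_natCast, ← Real.rpow_mul (norm_nonneg _)]; congr 1; push_cast; ring
    rw [this]
    exact Real.rpow_le_rpow (by positivity) (by linarith) (by positivity)
  -- choice of δ
  obtain ⟨δ, hδ0, hδ1, hδ2⟩ : ∃ δ : ℝ, 0 < δ ∧ δ * Real.exp (K * T) ≤ 1 ∧
      δ * Real.exp (K * T) * w x₁ ≤ d / 3 := by
    refine ⟨min 1 (d / 3 / w x₁) / Real.exp (K * T), ?_, ?_, ?_⟩
    · have := hw1 x₁
      positivity
    · rw [div_mul_cancel₀ _ (Real.exp_pos _).ne']; exact min_le_left _ _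
    · rw [div_mul_cancel₀ _ (Real.exp_pos _).ne']
      have hwp : 0 < w x₁ := by linarith [hw1 x₁]
      calc _ ≤ d / 3 / w x₁ * w x₁ := by gcongr; exact min_le_right _ _
        _ = d / 3 := by field_simp
  set s : ℝ → ℝ := fun t => δ * Real.exp (K * t) with hs
  have hspos : ∀ t, 0 < s t := fun t => by positivity
  have hsδ : ∀ t, 0 ≤ t → δ ≤ s t := fun t ht => by
    have : 1 ≤ Real.exp (K * t) := Real.one_le_exp (by positivity)
    simp only [hs]; nlinarith
  have hsT : ∀ t, t ≤ T → s t ≤ δ * Real.exp (K * T) := fun t ht => by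
    simp only [hs]; gcongr
  obtain ⟨T', hT'1, hT'2⟩ := exists_between ht₁.2
  have ht₁0 : 0 < t₁ := ht₁.1
  -- far field
  obtain ⟨R₀, hR₀⟩ := hgrow (δ / 2) (by positivity)
  have hfar : ∃ R : ℝ, R₀ ≤ R ∧ 0 < R ∧ ‖x₁ - z‖ < R ∧ |m| < δ / 2 * R ^ β := by
    have ht : Filter.Tendsto (fun R : ℝ => δ / 2 * R ^ β) Filter.atTop Filter.atTop :=
      (tendsto_rpow_atTop hβpos).const_mul_atTop (by positivity)
    have := ((Filter.eventually_ge_atTop R₀).and ((Filter.eventually_gt_atTop 0).and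
      ((Filter.eventually_gt_atTop ‖x₁ - z‖).and (ht.eventually_gt_atTop |m|)))).exists
    exact this
  obtain ⟨R, hRR₀, hR0, hRx, hRm⟩ := hfar
  have hlow : ∀ x t, t ∈ Ioo 0 T → R ≤ ‖x - z‖ → 0 < u (x, t) - (m - s t * w x) := by
    intro x t ht hx
    have h1 := hR₀ ‖x - z‖ (hRR₀.trans hx) x t le_rfl ht
    have h2 := hwr x
    have h3 : R ^ β ≤ ‖x - z‖ ^ β := Real.rpow_le_rpow hR0.le hx hβpos.le
    have h4 : δ * w x ≤ s t * w x :=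
      mul_le_mul_of_nonneg_right (hsδ t ht.1.le) (by linarith [hw1 x])
    have h5 := le_abs_self m
    nlinarith
  -- compact set
  set Kc : Set (EuclideanSpace ℝ (Fin n) × ℝ) := Metric.closedBall z R ×ˢ Icc 0 T' with hKc
  have hKcomp : IsCompact Kc := (isCompact_closedBall z R).prod isCompact_Icc
  have hKsub : Kc ⊆ univ ×ˢ Ico 0 T := by
    rintro ⟨x, t⟩ ⟨_, ht⟩
    exact ⟨mem_univ _, ht.1, ht.2.trans_lt hT'2⟩
  have hmem1 : (x₁, t₁) ∈ Kc := by
    refine ⟨?_, ht₁0.le, hT'1.le⟩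
    simp only [Metric.mem_closedBall, dist_eq_norm]; exact hRx.le
  obtain ⟨p₀, hp₀, hp₀min⟩ := (hlsc.mono hKsub).exists_isMinOn ⟨_, hmem1⟩ hKcomp
  obtain ⟨N, hN0, hN⟩ : ∃ N : ℝ, 0 < N ∧ m - u p₀ < d / 3 * Real.exp (N * (T' - t₁)) := by
    have hT'' : 0 < T' - t₁ := by linarith
    have ht : Filter.Tendsto (fun N : ℝ => d / 3 * Real.exp (N * (T' - t₁)))
        Filter.atTop Filter.atTop :=
      (Real.tendsto_exp_atTop.comp (Filter.tendsto_id.atTop_mul_const hT'')).const_mul_atTop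
        (by positivity)
    exact ((Filter.eventually_gt_atTop 0).and (ht.eventually_gt_atTop _)).exists
  set c : ℝ → ℝ := fun t => m - η * t - d / 3 * Real.exp (N * (t - t₁)) with hc
  set φ : EuclideanSpace ℝ (Fin n) → ℝ → ℝ := fun x t => c t - s t * w x with hφ
  have hwcd : ContDiff ℝ 2 w := aux_contDiff z (β / 2)
  have hφx : ∀ t, ContDiff ℝ 2 fun x => φ x t := fun t =>
    contDiff_const.sub (contDiff_const.mul hwcd)
  have hφt : ∀ x, ContDiff ℝ 1 fun t => φ x t := fun x => by
    simp only [hφ, hc, hs]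
    fun_prop
  have hφjoint : Continuous fun p : EuclideanSpace ℝ (Fin n) × ℝ => φ p.1 p.2 := by
    have := hwcd.continuous
    simp only [hφ, hc, hs]
    fun_prop
  have hlscφ : LowerSemicontinuousOn (fun p => u p - φ p.1 p.2) Kc := by
    have h1 : LowerSemicontinuousOn (fun p : EuclideanSpace ℝ (Fin n) × ℝ => -φ p.1 p.2) Kc :=
      hφjoint.neg.lowerSemicontinuous.lowerSemicontinuousOn _
    have := (hlsc.mono hKsub).add h1
    simpa [sub_eq_add_neg] using this
  obtain ⟨⟨x₀, t₀⟩, hmem0, hmin⟩ := hlscφ.exists_isMinOn ⟨_, hmem1⟩ hKcomp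
  have hneg : u (x₀, t₀) - φ x₀ t₀ < 0 := by
    have h1 : u (x₀, t₀) - φ x₀ t₀ ≤ u (x₁, t₁) - φ x₁ t₁ := hmin hmem1
    have h2 : s t₁ * w x₁ ≤ d / 3 :=
      (mul_le_mul_of_nonneg_right (hsT t₁ ht₁.2.le) (by linarith [hw1 x₁])).trans hδ2
    have h3 : φ x₁ t₁ = m - η * t₁ - d / 3 - s t₁ * w x₁ := by simp [hφ, hc]
    linarith
  have hφle : ∀ x t, 0 ≤ t → φ x t ≤ m - s t * w x - d / 3 * Real.exp (N * (t - t₁)) := by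
    intro x t ht
    have : 0 ≤ η * t := by positivity
    simp only [hφ, hc]; linarith
  have hswpos : 0 < s t₀ * w x₀ := mul_pos (hspos _) (by linarith [hw1 x₀])
  have hexppos : 0 < d / 3 * Real.exp (N * (t₀ - t₁)) := by positivity
  have hb := hφle x₀ t₀ hmem0.2.1
  have ht₀pos : 0 < t₀ := by
    rcases hmem0.2.1.lt_or_eq with h | h
    · exact h
    · exfalso
      simp only at h
      have := hinit x₀
      rw [h] at this
      linarith
  have ht₀lt : t₀ < T' := by
    rcases hmem0.2.2.lt_or_eq with h | h
    · exact h
    · exfalso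
      simp only at h
      have h1 : u p₀ ≤ u (x₀, t₀) := hp₀min hmem0
      rw [← h] at hN
      linarith
  have hx₀lt : ‖x₀ - z‖ < R := by
    by_contra hge
    push Not at hge
    have := hlow x₀ t₀ ⟨ht₀pos, ht₀lt.trans hT'2⟩ hge
    linarith
  have hΩ : (x₀, t₀) ∈ (univ : Set (EuclideanSpace ℝ (Fin n))) ×ˢ Ioo 0 T :=
    ⟨mem_univ _, ht₀pos, ht₀lt.trans hT'2⟩
  have hloc : IsLocalMinOn (fun p => u p - φ p.1 p.2)
      ((univ : Set (EuclideanSpace ℝ (Fin n))) ×ˢ Ioo 0 T) (x₀, t₀) := by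
    have hnhds : Kc ∈ nhds (x₀, t₀) := by
      apply prod_mem_nhds
      · apply Metric.closedBall_mem_nhds_of_mem
        simpa [dist_eq_norm] using hx₀lt
      · exact Icc_mem_nhds ht₀pos ht₀lt
    exact (hmin.isLocalMin hnhds).on _
  have hfin := hsuper φ hφx hφt x₀ t₀ hΩ hloc
  have hderiv : deriv (φ x₀) t₀ =
      -η - d / 3 * (N * Real.exp (N * (t₀ - t₁))) - K * s t₀ * w x₀ := by
    have h1 : HasDerivAt (fun t => Real.exp (N * (t - t₁)))
        (Real.exp (N * (t₀ - t₁)) * (N * 1)) t₀ :=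
      (((hasDerivAt_id t₀).sub_const t₁).const_mul N).exp
    have h2 : HasDerivAt (fun t => Real.exp (K * t)) (Real.exp (K * t₀) * (K * 1)) t₀ :=
      ((hasDerivAt_id t₀).const_mul K).exp
    have h3 : HasDerivAt (φ x₀) _ t₀ :=
      ((((hasDerivAt_id t₀).const_mul η).const_sub m).sub (h1.const_mul (d / 3))).sub
        ((h2.const_mul δ).mul_const (w x₀))
    rw [h3.deriv]
    simp only [hs]; ring
  have hst1 : s t₀ ≤ 1 := (hsT t₀ (ht₀lt.trans hT'2).le).trans hδ1
  obtain ⟨hq, hHlow⟩ := hC x₀ (c t₀) (s t₀) (Z (u (x₀, t₀))) (hspos _) hst1 (hZnonneg _) _ rfl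
  simp only [hderiv] at hfin
  set q := spaceGrad (fun y : EuclideanSpace ℝ (Fin n) =>
          c t₀ - s t₀ * (1 + ‖y - z‖ ^ 2) ^ (β / 2)) x₀ with hqdef
  have hfin' : H q (spaceHess (fun y : EuclideanSpace ℝ (Fin n) =>
          c t₀ - s t₀ * (1 + ‖y - z‖ ^ 2) ^ (β / 2)) x₀ + Z (u (x₀, t₀)) • outerProd q)
      + χ t₀ * ‖q‖ ^ σ
      - (-η - d / 3 * (N * Real.exp (N * (t₀ - t₁))) - K * s t₀ * w x₀) ≤ 0 := hfin
  have hy := hyoung (s t₀) (1 + ‖x₀ - z‖ ^ 2) ‖q‖ (hspos _) hst1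
    (by have := sq_nonneg ‖x₀ - z‖; linarith) (norm_nonneg _) hq
  have hχ : -(M * ‖q‖ ^ σ) ≤ χ t₀ * ‖q‖ ^ σ := by
    have h1 := (abs_le.mp (hM t₀ hΩ.2)).1
    have h2 : 0 ≤ ‖q‖ ^ σ := by positivity
    nlinarith
  have hpos : 0 < d / 3 * (N * Real.exp (N * (t₀ - t₁))) := by positivity
  have hKe : K * s t₀ * w x₀ = C * s t₀ * (1 + ‖x₀ - z‖ ^ 2) ^ (β / 2)
      + K' * s t₀ * (1 + ‖x₀ - z‖ ^ 2) ^ (β / 2) := by rw [hKdef, hw]; ring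
  linarith

end aux

/-- **Theorem 2.7(a)** (minimum principle, `k > 1`, `0 ≤ σ ≤ γ/2`).
Here `γ = k₁ + 2 > 2`, `γ* = (k₁+2)/k₁`, and no assumption is made on `Λ^inf`. -/
theorem minimum_principle_k_gt_one_subcritical
    (n : ℕ) (hn : 2 ≤ n)
    (H : EuclideanSpace ℝ (Fin n) → Matrix (Fin n) (Fin n) ℝ → ℝ) (k₁ : ℝ)
    (hH : ConditionsABC n H k₁) (hk₁ : 0 < k₁)
    (hΛ : LambdaSupFinite n H)
    (T : ℝ) (hT : 0 < T)
    (h : EuclideanSpace ℝ (Fin n) → ℝ) (hhcont : Continuous h)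
    (hhbdd : BddBelow (Set.range h))
    (Z : ℝ → ℝ) (hZcont : Continuous Z) (hZanti : Antitone Z) (hZnonneg : ∀ s, 0 ≤ Z s)
    (χ : ℝ → ℝ) (hχcont : ContinuousOn χ (Ioo 0 T))
    (hχbdd : BddAbove ((fun t => |χ t|) '' Ioo 0 T))
    (σ : ℝ) (hσ0 : 0 ≤ σ) (hσγ : σ ≤ (k₁ + 2) / 2)
    (u : EuclideanSpace ℝ (Fin n) × ℝ → ℝ)
    (hlsc : LowerSemicontinuousOn u (univ ×ˢ Ico 0 T))
    (hsuper : ParabolicSupersolution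
      (fun t r q X pt => H q (X + Z r • outerProd q) + χ t * ‖q‖ ^ σ - pt)
      (univ ×ˢ Ioo 0 T) u)
    (hinit : ∀ x, h x ≤ u (x, 0))
    (z : EuclideanSpace ℝ (Fin n))
    (hgrow : ∀ ε > (0:ℝ), ∃ R₀ : ℝ, ∀ R ≥ R₀, ∀ (x : EuclideanSpace ℝ (Fin n)) (t : ℝ),
      ‖x - z‖ ≤ R → t ∈ Ioo 0 T → -u (x, t) ≤ ε * R ^ ((k₁ + 2) / k₁)) :
    (σ = 0 → ∀ (x : EuclideanSpace ℝ (Fin n)), ∀ t ∈ Ioo 0 T,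
        (⨅ y, h y) - t * sSup ((fun s => |χ s|) '' Ioo 0 T) ≤ u (x, t)) ∧
    (0 < σ → ∀ (x : EuclideanSpace ℝ (Fin n)), ∀ t ∈ Ioo 0 T,
        (⨅ y, h y) ≤ u (x, t)) := by
  have hinit' : ∀ x, (⨅ y, h y) ≤ u (x, 0) := fun x => (ciInf_le hhbdd x).trans (hinit x)
  set M := sSup ((fun s => |χ s|) '' Ioo 0 T) with hMdef
  have hM : ∀ t ∈ Ioo 0 T, |χ t| ≤ M := fun t ht => le_csSup hχbdd ⟨t, ht, rfl⟩
  have hM0 : 0 ≤ M := (abs_nonneg _).trans (hM (T / 2) ⟨by linarith, by linarith⟩)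
  constructor
  · intro hσ x t ht
    have := aux_compare H k₁ hH hk₁ T Z hZnonneg χ σ u hlsc hsuper _ hinit' z hgrow M M 0 hM hM0
      le_rfl (by intro s ρ q _ _ _ _ _; simp [hσ]) x t ht
    linarith
  · intro hσ x t ht
    apply le_of_forall_pos_le_add
    intro ε hε
    have htp : 0 < t := ht.1
    obtain ⟨K, hK0, hK⟩ := aux_young k₁ σ M (ε / t) hk₁ hσ hσγ hM0 (by positivity)
    have := aux_compare H k₁ hH hk₁ T Z hZnonneg χ σ u hlsc hsuper _ hinit' z hgrow M (ε / t) K hM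
      (by positivity) hK0 hK x t ht
    rw [div_mul_cancel₀ _ htp.ne'] at this
    linarith
end
end

section
/- Minimum principle, degenerate case k>1, supercritical gradient power (Theorem 2.7(b)): Suppose H satisfies Conditions A–C with k₁ > 0 (so k > 1 and γ > 2) and Λ^sup < ∞ (no assumption is made on Λ^inf). Let h : ℝⁿ → ℝ be continuous with inf_{ℝⁿ} h > −∞, let Z : (−∞,∞) → [0,∞) be continuous and non-increasing, let χ : (0,T) → ℝ be bounded and continuous, and let σ > γ/2. Let u be lower semicontinuous on ℝⁿ × [0,T), a viscosity supersolution of H(Du, D²u + Z(u)Du⊗Du) + χ(t)|Du|^σ − u_t = 0 in ℝⁿ_T, with u(x,0) ≥ h(x) for all x ∈ ℝⁿ. If sup_{B^R_T} (−u) = o(R^{σ*}) as R → ∞, then u(x,t) ≥ inf_{ℝⁿ} h for all (x,t) ∈ ℝⁿ_T. -/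
open Set MeasureTheory

noncomputable section

namespace MinPrin

variable {n : ℕ}

/-- `1 + |x - z|²`. -/
def sq1 (z x : EuclideanSpace ℝ (Fin n)) : ℝ := 1 + ‖x - z‖ ^ 2

lemma sq1_pos (z x : EuclideanSpace ℝ (Fin n)) : 0 < sq1 z x := by
  unfold sq1; positivity

lemma one_le_sq1 (z x : EuclideanSpace ℝ (Fin n)) : 1 ≤ sq1 z x := by
  unfold sq1; nlinarith [sq_nonneg ‖x - z‖]

lemma contDiff_sq1 (z : EuclideanSpace ℝ (Fin n)) : ContDiff ℝ 2 (sq1 z) := by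
  unfold sq1
  exact contDiff_const.add ((contDiff_id.sub contDiff_const).norm_sq ℝ)

lemma hasFDerivAt_sq1 (z x : EuclideanSpace ℝ (Fin n)) :
    HasFDerivAt (sq1 z) ((2:ℝ) • innerSL ℝ (x - z)) x := by
  unfold sq1
  have h1 : HasFDerivAt (fun y : EuclideanSpace ℝ (Fin n) => y - z)
    (ContinuousLinearMap.id ℝ _) x := (hasFDerivAt_id x).sub_const z
  have h2 := (h1.norm_sq).const_add 1
  refine h2.congr_fderiv ?_
  ext v
  simp

lemma hasFDerivAt_rpow (p : ℝ) (z x : EuclideanSpace ℝ (Fin n)) :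
    HasFDerivAt (fun y => sq1 z y ^ p)
      ((p * sq1 z x ^ (p - 1)) • (2:ℝ) • innerSL ℝ (x - z)) x :=
  (hasFDerivAt_sq1 z x).rpow_const (Or.inl (sq1_pos z x).ne')

lemma inner_single (y : EuclideanSpace ℝ (Fin n)) (j : Fin n) :
    innerSL ℝ y (EuclideanSpace.single j (1:ℝ)) = y j := by
  simp [EuclideanSpace.inner_single_right]

lemma fderiv_barrier (c a p : ℝ) (z x v : EuclideanSpace ℝ (Fin n)) :
    fderiv ℝ (fun y => c - a * sq1 z y ^ p) x v =
      -(2 * a * p) * (sq1 z x ^ (p - 1) * innerSL ℝ (x - z) v) := by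
  have := ((hasFDerivAt_rpow p z x).const_mul a).const_sub c
  rw [this.fderiv]
  simp
  ring

lemma spaceGrad_barrier (c a p : ℝ) (z x : EuclideanSpace ℝ (Fin n)) :
    spaceGrad (fun y => c - a * sq1 z y ^ p) x =
      (-(2 * a * p) * sq1 z x ^ (p - 1)) • (x - z) := by
  ext i
  unfold spaceGrad
  simp only [fderiv_barrier, inner_single]
  simp
  ring

lemma spaceHess_barrier (c a p : ℝ) (z x : EuclideanSpace ℝ (Fin n)) :
    spaceHess (fun y => c - a * sq1 z y ^ p) x =
      (-(4 * a * p * (p - 1)) * sq1 z x ^ (p - 2)) • outerProd (x - z) +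
        (-(2 * a * p) * sq1 z x ^ (p - 1)) • (1 : Matrix (Fin n) (Fin n) ℝ) := by
  ext i j
  unfold spaceHess
  simp only [fderiv_barrier, inner_single]
  have h1 : HasFDerivAt (fun y : EuclideanSpace ℝ (Fin n) => (y - z) j)
      (EuclideanSpace.proj j : EuclideanSpace ℝ (Fin n) →L[ℝ] ℝ) x := by
    have := (EuclideanSpace.proj j : EuclideanSpace ℝ (Fin n) →L[ℝ] ℝ).hasFDerivAt (x := x)
    simpa using this.sub_const (z j)
  have h2 := ((hasFDerivAt_rpow (p - 1) z x).mul h1).const_mul (-(2 * a * p))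
  simp only [Matrix.of_apply]
  erw [h2.fderiv]
  have e : p - 1 - 1 = p - 2 := by ring
  rw [e]
  simp only [smul_apply, add_apply, inner_single,
    outerProd, Matrix.add_apply, Matrix.smul_apply, Matrix.of_apply, Matrix.one_apply, smul_eq_mul]
  simp only [PiLp.proj_apply, PiLp.single_apply, eq_comm (a := j)]
  ring

lemma outer_isSymm (q : EuclideanSpace ℝ (Fin n)) : (outerProd q).IsSymm := by
  ext i j; simp [outerProd, mul_comm]

lemma outer_posSemidef (q : EuclideanSpace ℝ (Fin n)) : (outerProd q).PosSemidef := by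
  have := Matrix.posSemidef_vecMulVec_self_star (R := ℝ) (fun i => q i)
  convert this using 1
  ext i j
  simp [outerProd, Matrix.vecMulVec_apply]

lemma outer_le (q : EuclideanSpace ℝ (Fin n)) :
    ((‖q‖ ^ 2) • (1 : Matrix (Fin n) (Fin n) ℝ) - outerProd q).PosSemidef := by
  refine Matrix.PosSemidef.of_dotProduct_mulVec_nonneg ?_ ?_
  · ext i j
    simp [outerProd, Matrix.one_apply, mul_comm, eq_comm]
  · intro v
    have hcs := real_inner_mul_inner_self_le q (WithLp.toLp 2 v)
    have e1 : inner ℝ q (WithLp.toLp 2 v) = ∑ i, q i * v i := by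
      simp [PiLp.inner_apply, mul_comm]
    have e2 : inner ℝ (WithLp.toLp 2 v) (WithLp.toLp 2 v) = ∑ i, v i * v i := by
      simp only [PiLp.inner_apply, RCLike.inner_apply, conj_trivial]
    rw [real_inner_self_eq_norm_sq, e1, e2] at hcs
    have e3 : (outerProd q).mulVec v = fun i => q i * ∑ j, q j * v j := by
      ext i
      simp only [outerProd, Matrix.mulVec, dotProduct, Matrix.of_apply, Finset.mul_sum, mul_assoc]
    rw [Matrix.sub_mulVec, Matrix.smul_mulVec, Matrix.one_mulVec, e3]
    simp only [dotProduct, Pi.sub_apply, Pi.smul_apply, smul_eq_mul, star_trivial, mul_sub,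
      Finset.sum_sub_distrib]
    have e4 : ∑ i, v i * (q i * ∑ j, q j * v j) = (∑ i, q i * v i) * ∑ i, q i * v i := by
      rw [Finset.sum_mul]
      refine Finset.sum_congr rfl fun i _ => by ring
    have e5 : ∑ i, v i * (‖q‖ ^ 2 * v i) = ‖q‖ ^ 2 * ∑ i, v i * v i := by
      rw [Finset.mul_sum]
      refine Finset.sum_congr rfl fun i _ => by ring
    rw [e4, e5]
    linarith

/-- Lower bound on `H(q,-I)`. -/
lemma H_neg_bound {H : EuclideanSpace ℝ (Fin n) → Matrix (Fin n) (Fin n) ℝ → ℝ} {k₁ : ℝ}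
    (hH : ConditionsABC n H k₁) (hk₁ : 0 < k₁) :
    ∃ c : ℝ, 0 ≤ c ∧ ∀ q, -c * ‖q‖ ^ k₁ ≤ H q (-1) := by
  have hc : Continuous fun q => H q (-1) :=
    hH.continuous.comp (continuous_id.prodMk continuous_const)
  obtain ⟨c, hc⟩ := ((isCompact_sphere (0 : EuclideanSpace ℝ (Fin n)) 1).image hc).bddBelow
  refine ⟨|c|, abs_nonneg _, fun q => ?_⟩
  by_cases hq : q = 0
  · have := hH.hom_q 0 0 (-1)
    simp [Real.zero_rpow hk₁.ne'] at this
    simp [hq, this, Real.zero_rpow hk₁.ne']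
  · have hn : 0 < ‖q‖ := norm_pos_iff.2 hq
    have e : q = ‖q‖ • (‖q‖⁻¹ • q) := by
      rw [smul_smul, mul_inv_cancel₀ hn.ne', one_smul]
    have h1 : c ≤ H (‖q‖⁻¹ • q) (-1) := by
      apply hc
      refine ⟨_, ?_, rfl⟩
      simp [norm_smul, hn.ne']
    have h2 := hH.hom_q ‖q‖ (‖q‖⁻¹ • q) (-1)
    rw [← e, abs_of_pos hn] at h2
    rw [h2]
    have := Real.rpow_nonneg hn.le k₁
    nlinarith [neg_abs_le c]

/-- The barrier estimate. -/
lemma barrier_bound {H : EuclideanSpace ℝ (Fin n) → Matrix (Fin n) (Fin n) ℝ → ℝ} {k₁ : ℝ}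
    (hH : ConditionsABC n H k₁) (hk₁ : 0 < k₁) (σ : ℝ) (hσγ : (k₁ + 2) / 2 < σ) (K : ℝ)
    (hK : 0 ≤ K) :
    ∃ C : ℝ, 0 ≤ C ∧ ∀ (a c ζ b : ℝ) (z x : EuclideanSpace ℝ (Fin n)), 0 < a → a ≤ 1 → 0 ≤ ζ →
      |b| ≤ K →
      let ψ := fun y => c - a * sq1 z y ^ (σ / (σ - 1) / 2);
      (-C) * a * sq1 z x ^ (σ / (σ - 1) / 2) ≤
        H (spaceGrad ψ x) (spaceHess ψ x + ζ • outerProd (spaceGrad ψ x))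
          + b * ‖spaceGrad ψ x‖ ^ σ := by
  obtain ⟨c₀, hc₀, hneg⟩ := H_neg_bound hH hk₁
  have hσ : 1 < σ := by linarith
  set p := σ / (σ - 1) / 2 with hp
  have hp0 : 0 < p := by
    have : 0 < σ - 1 := by linarith
    positivity
  set D := 2 * p + 4 * p * |p - 1| with hD
  have hDpos : 0 < D := by positivity
  refine ⟨D * (2 * p) ^ k₁ * c₀ + K * (2 * p) ^ σ, by positivity, ?_⟩
  intro a c ζ b z x ha ha1 hζ hb ψ
  have hgrad : spaceGrad ψ x = (-(2 * a * p) * sq1 z x ^ (p - 1)) • (x - z) :=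
    spaceGrad_barrier c a p z x
  have hhess : spaceHess ψ x = _ := spaceHess_barrier c a p z x
  set s := sq1 z x with hs
  have hs0 : 0 < s := sq1_pos z x
  have hs1 : 1 ≤ s := one_le_sq1 z x
  set q := spaceGrad ψ x with hq
  have hyle : ‖x - z‖ ≤ s ^ (1 / 2 : ℝ) := by
    rw [← Real.sqrt_eq_rpow]
    apply Real.le_sqrt_of_sq_le
    rw [hs, sq1]; linarith
  have hqn : ‖q‖ ≤ (2 * p) * a * s ^ (p - 1 / 2) := by
    rw [hgrad, norm_smul, Real.norm_eq_abs, abs_mul, abs_neg,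
      abs_of_pos (show 0 < 2 * a * p by positivity), abs_of_pos (Real.rpow_pos_of_pos hs0 _)]
    calc 2 * a * p * s ^ (p - 1) * ‖x - z‖ ≤ 2 * a * p * s ^ (p - 1) * s ^ (1 / 2 : ℝ) := by
          gcongr
      _ = 2 * p * a * (s ^ (p - 1) * s ^ (1 / 2 : ℝ)) := by ring
      _ = _ := by rw [← Real.rpow_add hs0]; congr 2; ring
  have hpow : ∀ r : ℝ, 0 ≤ r → ‖q‖ ^ r ≤ (2 * p) ^ r * a ^ r * s ^ ((p - 1 / 2) * r) := by
    intro r hr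
    refine (Real.rpow_le_rpow (norm_nonneg _) hqn hr).trans_eq ?_
    rw [Real.mul_rpow (by positivity) (by positivity), Real.mul_rpow (by positivity) ha.le,
      ← Real.rpow_mul hs0.le]
  -- the gradient term
  have hT2 : -(K * (2 * p) ^ σ * a * s ^ p) ≤ b * ‖q‖ ^ σ := by
    have h1 := hpow σ (by linarith)
    have e : (p - 1 / 2) * σ = p := by
      rw [hp]
      have : σ - 1 ≠ 0 := by linarith
      field_simp
      ring
    rw [e] at h1
    have h2 : a ^ σ ≤ a := by
      simpa using Real.rpow_le_rpow_of_exponent_ge ha ha1 hσ.le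
    have h3 : ‖q‖ ^ σ ≤ (2 * p) ^ σ * a * s ^ p := h1.trans (by gcongr)
    have h4 : |b * ‖q‖ ^ σ| ≤ K * ((2 * p) ^ σ * a * s ^ p) := by
      rw [abs_mul, abs_of_nonneg (Real.rpow_nonneg (norm_nonneg q) σ)]
      gcongr
    have := neg_abs_le (b * ‖q‖ ^ σ)
    linarith
  -- the second order term
  have hT1 : -(D * (2 * p) ^ k₁ * c₀ * a * s ^ p) ≤ H q (spaceHess ψ x + ζ • outerProd q) := by
    have hmono : H q ((a * D * s ^ (p - 1)) • (-1)) ≤ H q (spaceHess ψ x + ζ • outerProd q) := by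
      apply hH.monotone
      · exact (Matrix.isSymm_one.neg).smul _
      · rw [hhess]
        exact (((outer_isSymm _).smul _).add (Matrix.isSymm_one.smul _)).add
          ((outer_isSymm _).smul _)
      · unfold LoewnerLE
        rw [hhess]
        have hss : s ^ (p - 1) = s ^ (p - 2) * s := by
          rw [← Real.rpow_add_one hs0.ne']; congr 1; ring
        set A := 4 * a * p * s ^ (p - 2) with hA
        have hA0 : 0 ≤ A := by positivity
        have key : (-(4 * a * p * (p - 1)) * s ^ (p - 2)) • outerProd (x - z) +
            (-(2 * a * p) * s ^ (p - 1)) • (1 : Matrix (Fin n) (Fin n) ℝ) + ζ • outerProd q -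
            (a * D * s ^ (p - 1)) • (-1) =
            (A * |p - 1|) • ((‖x - z‖ ^ 2) • (1 : Matrix (Fin n) (Fin n) ℝ) - outerProd (x - z)) +
            (A * (|p - 1| - (p - 1))) • outerProd (x - z) + (A * |p - 1|) •
            (1 : Matrix (Fin n) (Fin n) ℝ) + ζ • outerProd q := by
          have hsy : s = 1 + ‖x - z‖ ^ 2 := rfl
          ext i j
          simp only [Matrix.add_apply, Matrix.sub_apply, Matrix.smul_apply, Matrix.neg_apply,
            smul_eq_mul]
          rw [hss, hD, hA]
          generalize s ^ (p - 2) = w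
          rw [hsy]
          ring
        rw [key]
        refine (((outer_le _).smul ?_).add ((outer_posSemidef _).smul ?_)).add
          (Matrix.PosSemidef.one.smul ?_) |>.add ((outer_posSemidef _).smul hζ)
        · positivity
        · exact mul_nonneg hA0 (by linarith [le_abs_self (p - 1)])
        · positivity
    refine le_trans ?_ hmono
    rw [hH.hom_X _ (by positivity)]
    have h1 := hpow k₁ hk₁.le
    have h2 : a ^ k₁ ≤ 1 := Real.rpow_le_one ha.le ha1 hk₁.le
    have h3 : ‖q‖ ^ k₁ ≤ (2 * p) ^ k₁ * s ^ ((p - 1 / 2) * k₁) := by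
      refine h1.trans ?_
      have : (2 * p) ^ k₁ * a ^ k₁ ≤ (2 * p) ^ k₁ * 1 := by gcongr
      rw [mul_one] at this
      gcongr
    have h5 : s ^ (p - 1) * s ^ ((p - 1 / 2) * k₁) ≤ s ^ p := by
      rw [← Real.rpow_add hs0]
      apply Real.rpow_le_rpow_of_exponent_le hs1
      have : (p - 1 / 2) * k₁ ≤ 1 := by
        have e : p - 1 / 2 = 1 / (2 * (σ - 1)) := by
          rw [hp]
          have : σ - 1 ≠ 0 := by linarith
          field_simp
          ring
        rw [e, div_mul_eq_mul_div, div_le_one (by linarith)]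
        linarith
      linarith
    calc -(D * (2 * p) ^ k₁ * c₀ * a * s ^ p)
        ≤ -(D * (2 * p) ^ k₁ * c₀ * a * (s ^ (p - 1) * s ^ ((p - 1 / 2) * k₁))) := by
          apply neg_le_neg
          gcongr
      _ = a * D * s ^ (p - 1) * (-c₀ * ((2 * p) ^ k₁ * s ^ ((p - 1 / 2) * k₁))) := by ring
      _ ≤ a * D * s ^ (p - 1) * (-c₀ * ‖q‖ ^ k₁) := by
          apply mul_le_mul_of_nonneg_left _ (by positivity)
          rw [neg_mul, neg_mul]
          apply neg_le_neg
          gcongr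
      _ ≤ _ := by
          apply mul_le_mul_of_nonneg_left (hneg q) (by positivity)
  linarith

end MinPrin

/-- **Theorem 2.7(b)** (minimum principle, `k > 1`, `σ > γ/2`).
Here `γ = k₁ + 2 > 2`, `σ* = σ/(σ-1)`, and no assumption is made on `Λ^inf`. -/
theorem minimum_principle_k_gt_one_supercritical
    (n : ℕ) (hn : 2 ≤ n)
    (H : EuclideanSpace ℝ (Fin n) → Matrix (Fin n) (Fin n) ℝ → ℝ) (k₁ : ℝ)
    (hH : ConditionsABC n H k₁) (hk₁ : 0 < k₁)
    (hΛ : LambdaSupFinite n H)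
    (T : ℝ) (hT : 0 < T)
    (h : EuclideanSpace ℝ (Fin n) → ℝ) (hhcont : Continuous h)
    (hhbdd : BddBelow (Set.range h))
    (Z : ℝ → ℝ) (hZcont : Continuous Z) (hZanti : Antitone Z) (hZnonneg : ∀ s, 0 ≤ Z s)
    (χ : ℝ → ℝ) (hχcont : ContinuousOn χ (Ioo 0 T))
    (hχbdd : BddAbove ((fun t => |χ t|) '' Ioo 0 T))
    (σ : ℝ) (hσγ : (k₁ + 2) / 2 < σ)
    (u : EuclideanSpace ℝ (Fin n) × ℝ → ℝ)
    (hlsc : LowerSemicontinuousOn u (univ ×ˢ Ico 0 T))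
    (hsuper : ParabolicSupersolution
      (fun t r q X pt => H q (X + Z r • outerProd q) + χ t * ‖q‖ ^ σ - pt)
      (univ ×ˢ Ioo 0 T) u)
    (hinit : ∀ x, h x ≤ u (x, 0))
    (z : EuclideanSpace ℝ (Fin n))
    (hgrow : ∀ ε > (0:ℝ), ∃ R₀ : ℝ, ∀ R ≥ R₀, ∀ (x : EuclideanSpace ℝ (Fin n)) (t : ℝ),
      ‖x - z‖ ≤ R → t ∈ Ioo 0 T → -u (x, t) ≤ ε * R ^ (σ / (σ - 1))) :
    ∀ (x : EuclideanSpace ℝ (Fin n)), ∀ t ∈ Ioo 0 T, (⨅ y, h y) ≤ u (x, t) := by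
  classical
  intro x₁ t₁ ht₁
  by_contra hlt
  push Not at hlt
  set m := ⨅ y, h y with hm
  have hmu : ∀ x, m ≤ u (x, 0) := fun x => (ciInf_le hhbdd x).trans (hinit x)
  obtain ⟨K₀, hK₀⟩ := hχbdd
  have hK : ∀ t ∈ Ioo 0 T, |χ t| ≤ max K₀ 0 := fun t ht =>
    (hK₀ ⟨t, ht, rfl⟩).trans (le_max_left _ _)
  obtain ⟨C, hC0, hC⟩ := MinPrin.barrier_bound hH hk₁ σ hσγ (max K₀ 0) (le_max_right _ _)
  have hσ : 1 < σ := by linarith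
  have hstar : 0 < σ / (σ - 1) := div_pos (by linarith) (by linarith)
  set p := σ / (σ - 1) / 2 with hp
  have hpstar : σ / (σ - 1) = 2 * p := by rw [hp]; ring
  have hp0 : 0 < p := by positivity
  have hw1 : ∀ x, 1 ≤ MinPrin.sq1 z x ^ p := fun x =>
    Real.one_le_rpow (MinPrin.one_le_sq1 z x) hp0.le
  have hwR : ∀ x, ‖x - z‖ ^ (σ / (σ - 1)) ≤ MinPrin.sq1 z x ^ p := by
    intro x
    rw [hpstar, Real.rpow_mul (norm_nonneg _)]
    apply Real.rpow_le_rpow (by positivity) _ hp0.le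
    rw [Real.rpow_two, MinPrin.sq1]
    linarith
  set M := C + 1 with hM
  have hM0 : 0 < M := by linarith
  -- choice of the small parameter
  obtain ⟨ε, hε0, hε1, hε2⟩ : ∃ ε : ℝ, 0 < ε ∧ ε * Real.exp (M * T) ≤ 1 ∧
      u (x₁, t₁) + ε * (Real.exp (M * t₁) * MinPrin.sq1 z x₁ ^ p + 1) < m := by
    set W := Real.exp (M * t₁) * MinPrin.sq1 z x₁ ^ p + 1 with hW
    have hW0 : 0 < W := by have := hw1 x₁; positivity
    have hd : 0 < m - u (x₁, t₁) := by linarith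
    refine ⟨min (Real.exp (M * T))⁻¹ ((m - u (x₁, t₁)) / (2 * W)), ?_, ?_, ?_⟩
    · apply lt_min <;> positivity
    · calc _ ≤ (Real.exp (M * T))⁻¹ * Real.exp (M * T) := by
            gcongr; exact min_le_left _ _
        _ = 1 := inv_mul_cancel₀ (Real.exp_pos _).ne'
    · have : min (Real.exp (M * T))⁻¹ ((m - u (x₁, t₁)) / (2 * W)) * W ≤
          (m - u (x₁, t₁)) / (2 * W) * W := by
        gcongr; exact min_le_right _ _
      have e : (m - u (x₁, t₁)) / (2 * W) * W = (m - u (x₁, t₁)) / 2 := by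
        field_simp
      linarith
  -- choice of the radius
  obtain ⟨R₀, hR₀⟩ := hgrow (ε / 2) (by positivity)
  obtain ⟨R, hR1, hR2, hR3, hR4⟩ : ∃ R : ℝ, R₀ ≤ R ∧ 0 < R ∧ ‖x₁ - z‖ < R ∧
      m ≤ ε / 2 * R ^ (σ / (σ - 1)) := by
    have hev : ∀ᶠ R : ℝ in Filter.atTop, m ≤ ε / 2 * R ^ (σ / (σ - 1)) :=
      ((tendsto_rpow_atTop hstar).const_mul_atTop (show 0 < ε / 2 by positivity)).eventually_ge_atTop m
    obtain ⟨R, h1, h2, h3, h4⟩ := ((Filter.eventually_ge_atTop R₀).and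
      ((Filter.eventually_gt_atTop 0).and ((Filter.eventually_gt_atTop ‖x₁ - z‖).and hev))).exists
    exact ⟨R, h1, h2, h3, h4⟩
  set Q := ε / 2 * R ^ (σ / (σ - 1)) with hQ
  set T' := (t₁ + T) / 2 with hT'
  have ht₁0 := ht₁.1
  have ht₁T := ht₁.2
  have hT'1 : t₁ < T' := by rw [hT']; linarith
  have hT'2 : T' < T := by rw [hT']; linarith
  obtain ⟨N, hN0, hN⟩ : ∃ N : ℝ, 0 < N ∧ Q + m ≤ ε * Real.exp (N * (T' - t₁)) := by
    have : Filter.Tendsto (fun N : ℝ => ε * Real.exp (N * (T' - t₁))) Filter.atTop Filter.atTop :=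
      (Real.tendsto_exp_atTop.comp
        (Filter.tendsto_id.atTop_mul_const (sub_pos.2 hT'1))).const_mul_atTop hε0
    obtain ⟨N, h1, h2⟩ := ((Filter.eventually_gt_atTop 0).and
      (this.eventually_ge_atTop (Q + m))).exists
    exact ⟨N, h1, h2⟩
  set φ : EuclideanSpace ℝ (Fin n) → ℝ → ℝ := fun x t =>
    (m - ε * Real.exp (N * (t - t₁))) - (ε * Real.exp (M * t)) * MinPrin.sq1 z x ^ p with hφ
  have hwC : ContDiff ℝ 2 (fun x => MinPrin.sq1 z x ^ p) :=
    (MinPrin.contDiff_sq1 z).rpow_const_of_ne fun x => (MinPrin.sq1_pos z x).ne'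
  have hφx : ∀ t, ContDiff ℝ 2 fun x => φ x t := fun t =>
    contDiff_const.sub (contDiff_const.mul hwC)
  have hφt : ∀ x, ContDiff ℝ 1 fun t => φ x t := by
    intro x
    simp only [hφ]
    fun_prop
  have hφc : Continuous fun q : EuclideanSpace ℝ (Fin n) × ℝ => φ q.1 q.2 := by
    have := hwC.continuous
    have h2 : Continuous fun q : EuclideanSpace ℝ (Fin n) × ℝ => MinPrin.sq1 z q.1 ^ p :=
      this.comp continuous_fst
    simp only [hφ]
    fun_prop
  set f : EuclideanSpace ℝ (Fin n) × ℝ → ℝ := fun q => u q - φ q.1 q.2 with hf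
  set S : Set (EuclideanSpace ℝ (Fin n) × ℝ) := Metric.closedBall z R ×ˢ Icc 0 T' with hS
  have hScomp : IsCompact S := (isCompact_closedBall z R).prod isCompact_Icc
  have hSsub : S ⊆ univ ×ˢ Ico 0 T := by
    rintro ⟨x, t⟩ ⟨_, h2, h3⟩
    exact ⟨mem_univ _, h2, lt_of_le_of_lt h3 hT'2⟩
  have hflsc : LowerSemicontinuousOn f S := by
    have h1 : LowerSemicontinuousOn u S := hlsc.mono hSsub
    have h2 : LowerSemicontinuousOn (fun q : EuclideanSpace ℝ (Fin n) × ℝ => -φ q.1 q.2) S :=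
      hφc.neg.continuousOn.lowerSemicontinuousOn
    have := h1.add h2
    simpa [hf, sub_eq_add_neg] using this
  have h1S : (x₁, t₁) ∈ S := by
    refine ⟨?_, ht₁0.le, hT'1.le⟩
    rw [Metric.mem_closedBall, dist_eq_norm]
    exact hR3.le
  obtain ⟨⟨x₀, t₀⟩, h0S, hmin⟩ := hflsc.exists_isMinOn ⟨_, h1S⟩ hScomp
  have hf1 : f (x₁, t₁) < 0 := by
    simp only [hf, hφ, sub_self, mul_zero, Real.exp_zero]
    linarith
  have hf0 : f (x₀, t₀) < 0 := lt_of_le_of_lt (hmin h1S) hf1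
  have hfe : f (x₀, t₀) = u (x₀, t₀) + (ε * Real.exp (M * t₀)) * MinPrin.sq1 z x₀ ^ p
      + ε * Real.exp (N * (t₀ - t₁)) - m := by
    simp only [hf, hφ]; ring
  have hx0R : ‖x₀ - z‖ ≤ R := by
    have := h0S.1
    rwa [Metric.mem_closedBall, dist_eq_norm] at this
  have hepos : 0 < ε * Real.exp (N * (t₀ - t₁)) := by positivity
  have hwpos : 0 < (ε * Real.exp (M * t₀)) * MinPrin.sq1 z x₀ ^ p := by
    have := hw1 x₀; positivity
  have ht0pos : 0 < t₀ := by
    rcases h0S.2.1.lt_or_eq with h1 | h1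
    · exact h1
    · exfalso
      have := hmu x₀
      change 0 = t₀ at h1
      rw [h1] at this
      linarith
  have ht0T : t₀ < T := lt_of_le_of_lt h0S.2.2 hT'2
  have hu0 : -Q ≤ u (x₀, t₀) := by
    have := hR₀ R hR1 x₀ t₀ hx0R ⟨ht0pos, ht0T⟩
    linarith
  have ht0T' : t₀ < T' := by
    rcases h0S.2.2.lt_or_eq with h1 | h1
    · exact h1
    · exfalso
      change t₀ = T' at h1
      rw [← h1] at hN
      linarith
  have hx0lt : ‖x₀ - z‖ < R := by
    rcases hx0R.lt_or_eq with h1 | h1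
    · exact h1
    · exfalso
      have h2 := hwR x₀
      rw [h1] at h2
      have h3 : 1 ≤ Real.exp (M * t₀) := Real.one_le_exp (by positivity)
      have h4 : 2 * Q ≤ (ε * Real.exp (M * t₀)) * MinPrin.sq1 z x₀ ^ p := by
        calc 2 * Q = (ε * 1) * R ^ (σ / (σ - 1)) := by rw [hQ]; ring
          _ ≤ _ := by gcongr
      linarith
  have hloc : IsLocalMinOn (fun q => u q - φ q.1 q.2) (univ ×ˢ Ioo 0 T) (x₀, t₀) := by
    have hnb : S ∈ nhds (x₀, t₀) := by
      apply prod_mem_nhds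
      · apply Metric.closedBall_mem_nhds_of_mem
        rw [Metric.mem_ball, dist_eq_norm]; exact hx0lt
      · exact Icc_mem_nhds ht0pos ht0T'
    exact (hmin.isLocalMin hnb).on _
  have hfin := hsuper φ hφx hφt x₀ t₀ ⟨mem_univ _, ht0pos, ht0T⟩ hloc
  have ha1 : ε * Real.exp (M * t₀) ≤ 1 := by
    refine le_trans ?_ hε1
    gcongr
  have hb := hC (ε * Real.exp (M * t₀)) (m - ε * Real.exp (N * (t₀ - t₁))) (Z (u (x₀, t₀)))
    (χ t₀) z x₀ (by positivity) ha1 (hZnonneg _) (hK t₀ ⟨ht0pos, ht0T⟩)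
  have hder : deriv (φ x₀) t₀ = -(ε * N * Real.exp (N * (t₀ - t₁))) -
      (ε * M * Real.exp (M * t₀)) * MinPrin.sq1 z x₀ ^ p := by
    have e1 : HasDerivAt (fun t : ℝ => N * (t - t₁)) (N * 1) t₀ :=
      ((hasDerivAt_id t₀).sub_const t₁).const_mul N
    have e2 : HasDerivAt (fun t : ℝ => M * t) (M * 1) t₀ := (hasDerivAt_id t₀).const_mul M
    have e3 := ((e1.exp.const_mul ε).const_sub m).sub
      ((e2.exp.const_mul ε).mul_const (MinPrin.sq1 z x₀ ^ p))
    have e4 : HasDerivAt (φ x₀) _ t₀ := e3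
    rw [e4.deriv]
    ring
  rw [hder] at hfin
  have hNpos : 0 < ε * N * Real.exp (N * (t₀ - t₁)) := by positivity
  simp only [hφ] at hfin
  simp only at hb
  rw [hM] at hfin hwpos hb
  nlinarith
end
end

section
/- Maximum principle, case k=1, σ=0 (Theorem 2.9(a)): Suppose H satisfies Conditions A–C with k₁ = 0 (so k = 1, γ = 2; by the homogeneity in Condition B and continuity, H(q,X) is then independent of q and is written H(X)) and Λ^sup < ∞. Let h : ℝⁿ → ℝ be continuous with sup_{ℝⁿ} h < ∞, let m ∈ ℝ, let Z : [m,∞) → [0,∞) be continuous and non-increasing, and let χ : (0,T) → ℝ be bounded and continuous. Let u be upper semicontinuous on ℝⁿ × [0,T) with inf u > m, a viscosity subsolution of H(D²u + Z(u)Du⊗Du) + χ(t) − u_t = 0 in ℝⁿ_T (the case σ = 0), with u(x,0) ≤ h(x) for all x ∈ ℝⁿ. If sup_{B^R_T} u = e^{o(R²)} as R → ∞, then u(x,t) ≤ sup_{ℝⁿ} h + t·sup_{(0,T)}|χ(t)| for all (x,t) ∈ ℝⁿ_T. -/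
open Set MeasureTheory

noncomputable section

lemma fderiv_test {n : ℕ} (a δ b : ℝ) (z y v : EuclideanSpace ℝ (Fin n)) :
    fderiv ℝ (fun x : EuclideanSpace ℝ (Fin n) => a + δ * Real.exp (‖x - z‖ ^ 2 + b)) y v
      = 2 * δ * (Real.exp (‖y - z‖ ^ 2 + b) * inner ℝ (y - z) v) := by
  have h1 : HasFDerivAt (fun x : EuclideanSpace ℝ (Fin n) => x - z)
      (ContinuousLinearMap.id ℝ _) y := (hasFDerivAt_id y).sub_const z
  have h2 := (((h1.norm_sq.add_const b).exp).const_mul δ).const_add a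
  rw [h2.fderiv]
  simp [inner_sub_left]
  ring

lemma fderiv_test2 {n : ℕ} (δ b : ℝ) (z y v w : EuclideanSpace ℝ (Fin n)) :
    fderiv ℝ (fun x : EuclideanSpace ℝ (Fin n) =>
        2 * δ * (Real.exp (‖x - z‖ ^ 2 + b) * inner ℝ (x - z) v)) y w
      = 2 * δ * Real.exp (‖y - z‖ ^ 2 + b) *
        (inner ℝ w v + 2 * inner ℝ (y - z) w * inner ℝ (y - z) v) := by
  have h1 : HasFDerivAt (fun x : EuclideanSpace ℝ (Fin n) => x - z)
      (ContinuousLinearMap.id ℝ _) y := (hasFDerivAt_id y).sub_const z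
  have h3 := h1.inner ℝ (hasFDerivAt_const v y)
  have h2 := (((h1.norm_sq.add_const b).exp).mul h3).const_mul (2 * δ)
  refine (congrArg (fun f => f w) h2.fderiv).trans ?_
  simp [inner_sub_left]
  ring

lemma hess_bound {n : ℕ} (hn : 2 ≤ n)
    (H : EuclideanSpace ℝ (Fin n) → Matrix (Fin n) (Fin n) ℝ → ℝ)
    (hH : ConditionsABC n H 0) (C : ℝ)
    (hC : ∀ (lam : ℝ) (e : EuclideanSpace ℝ (Fin n)), ‖e‖ = 1 →
      H e (lam • outerProd e + 1) ≤ C) (a δ b ζ : ℝ) (hδ : 0 < δ)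
    (z y : EuclideanSpace ℝ (Fin n)) :
    H 0 (spaceHess (fun x => a + δ * Real.exp (‖x - z‖ ^ 2 + b)) y
      + ζ • outerProd (spaceGrad (fun x => a + δ * Real.exp (‖x - z‖ ^ 2 + b)) y))
      ≤ 2 * δ * Real.exp (‖y - z‖ ^ 2 + b) * C := by
  obtain ⟨r, e, he, hr⟩ : ∃ (r : ℝ) (e : EuclideanSpace ℝ (Fin n)), ‖e‖ = 1 ∧ y - z = r • e := by
    by_cases h0 : y - z = 0
    · exact ⟨0, EuclideanSpace.single ⟨0, by omega⟩ 1, by simp, by simp [h0]⟩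
    · refine ⟨‖y - z‖, ‖y - z‖⁻¹ • (y - z), norm_smul_inv_norm h0, ?_⟩
      rw [smul_smul, mul_inv_cancel₀ (norm_ne_zero_iff.mpr h0), one_smul]
  set E := Real.exp (‖y - z‖ ^ 2 + b) with hE
  have hEpos : 0 < E := Real.exp_pos _
  have key : spaceHess (fun x => a + δ * Real.exp (‖x - z‖ ^ 2 + b)) y
      + ζ • outerProd (spaceGrad (fun x => a + δ * Real.exp (‖x - z‖ ^ 2 + b)) y)
      = (2 * δ * E) • ((2 * r ^ 2 + ζ * (2 * δ * E) * r ^ 2) • outerProd e + 1) := by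
    ext i j
    have hyz : ∀ k, (y - z).ofLp k = r * e k := fun k => by rw [hr]; simp
    simp only [spaceHess, spaceGrad, outerProd, fderiv_test, Matrix.add_apply,
      Matrix.smul_apply, Matrix.of_apply, smul_eq_mul, Matrix.one_apply]
    rw [fderiv_test2, ← hE]
    simp only [EuclideanSpace.inner_single_right, hyz]
    by_cases hij : i = j
    · subst hij
      simp [EuclideanSpace.equiv, hyz, -PiLp.sub_apply]
      ring
    · have hji : ¬ j = i := fun h => hij h.symm
      simp [EuclideanSpace.equiv, hij, hji, hyz, -PiLp.sub_apply]
      ring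
  have hind : ∀ X, H 0 X = H e X := fun X => by
    have := hH.hom_q 0 e X
    simpa using this
  rw [key, hind, hH.hom_X _ (by positivity)]
  exact mul_le_mul_of_nonneg_left (hC _ e he) (by positivity)

/-- **Theorem 2.9(a)** (maximum principle, `k = 1`, `σ = 0`).
Since `k₁ = 0`, `H(q,X)` is independent of `q` and we write `H(X) = H(0,X)`. -/
theorem maximum_principle_k_eq_one_sigma_zero
    (n : ℕ) (hn : 2 ≤ n)
    (H : EuclideanSpace ℝ (Fin n) → Matrix (Fin n) (Fin n) ℝ → ℝ)
    (hH : ConditionsABC n H 0)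
    (hΛ : LambdaSupFinite n H)
    (T : ℝ) (hT : 0 < T)
    (h : EuclideanSpace ℝ (Fin n) → ℝ) (hhcont : Continuous h)
    (hhbdd : BddAbove (Set.range h))
    (m : ℝ) (Z : ℝ → ℝ)
    (hZcont : ContinuousOn Z (Ici m)) (hZanti : AntitoneOn Z (Ici m))
    (hZnonneg : ∀ s ∈ Ici m, 0 ≤ Z s)
    (χ : ℝ → ℝ) (hχcont : ContinuousOn χ (Ioo 0 T))
    (hχbdd : BddAbove ((fun t => |χ t|) '' Ioo 0 T))
    (u : EuclideanSpace ℝ (Fin n) × ℝ → ℝ)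
    (husc : UpperSemicontinuousOn u (univ ×ˢ Ico 0 T))
    (hinf : ∃ c, m < c ∧ ∀ (x : EuclideanSpace ℝ (Fin n)), ∀ t ∈ Ico 0 T, c ≤ u (x, t))
    (hsub : ParabolicSubsolution
      (fun t r q X pt => H 0 (X + Z r • outerProd q) + χ t - pt)
      (univ ×ˢ Ioo 0 T) u)
    (hinit : ∀ x, u (x, 0) ≤ h x)
    (z : EuclideanSpace ℝ (Fin n))
    (hgrow : ∀ ε > (0:ℝ), ∃ R₀ : ℝ, ∀ R ≥ R₀, ∀ (x : EuclideanSpace ℝ (Fin n)) (t : ℝ),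
      ‖x - z‖ ≤ R → t ∈ Ioo 0 T → u (x, t) ≤ Real.exp (ε * R ^ (2:ℕ))) :
    ∀ (x : EuclideanSpace ℝ (Fin n)), ∀ t ∈ Ioo 0 T,
      u (x, t) ≤ (⨆ y, h y) + t * sSup ((fun s => |χ s|) '' Ioo 0 T) := by
  obtain ⟨C, hC⟩ := hΛ
  have hCpos : 0 < C := by
    have he : ‖(EuclideanSpace.single (⟨0, by omega⟩ : Fin n) (1:ℝ))‖ = 1 := by simp
    have h1 := hC 0 _ he
    have h2 := hH.min_pos _ he
    simp only [zero_smul, zero_add] at h1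
    linarith
  set M := ⨆ y, h y with hM
  set K := sSup ((fun s => |χ s|) '' Ioo 0 T) with hK
  have hhM : ∀ x, h x ≤ M := fun x => le_ciSup hhbdd x
  have hχK : ∀ t ∈ Ioo 0 T, |χ t| ≤ K := fun t ht => le_csSup hχbdd ⟨t, ht, rfl⟩
  have hKnn : 0 ≤ K := (abs_nonneg _).trans (hχK (T / 2) ⟨by linarith, by linarith⟩)
  intro x₁ t₁ ht₁
  obtain ⟨T', hT1, hT2⟩ := exists_between ht₁.2
  have ht1pos := ht₁.1
  have main : ∀ δ > (0:ℝ), u (x₁, t₁) ≤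
      (M + K * t₁ + δ) + δ * Real.exp (‖x₁ - z‖ ^ 2 + 2 * C * t₁) := by
    intro δ hδ
    by_contra hcon
    push Not at hcon
    obtain ⟨R₀, hR₀⟩ := hgrow (1 / 2) (by norm_num)
    obtain ⟨R, hRR₀, hRY, hRx, hR1⟩ : ∃ R : ℝ, R₀ ≤ R ∧ (1 + |M|) / δ ≤ R ∧ ‖x₁ - z‖ ≤ R ∧ 1 ≤ R :=
      ⟨max (max R₀ ((1 + |M|) / δ)) (max ‖x₁ - z‖ 1), by simp, by simp, by simp, by simp⟩
    set Y := Real.exp (1 / 2 * R ^ 2) with hY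
    have hYR : R ≤ Y := by
      have := Real.add_one_le_exp (1 / 2 * R ^ 2)
      nlinarith [sq_nonneg (R - 1)]
    have hYsq : Real.exp (R ^ 2) = Y ^ 2 := by
      rw [hY, ← Real.exp_nat_mul]; congr 1; push_cast; ring
    have hYM : Y ≤ M + δ * Y ^ 2 := by
      have h1 : 1 + |M| ≤ δ * Y := by
        have := (div_le_iff₀ hδ).mp (hRY.trans hYR)
        linarith
      have h2 : -|M| ≤ M := neg_abs_le M
      have h3 : 0 ≤ |M| := abs_nonneg M
      have h4 : 1 ≤ Y := hR1.trans hYR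
      nlinarith [mul_le_mul_of_nonneg_left h1 (by linarith : (0:ℝ) ≤ Y),
        mul_le_mul_of_nonneg_left h4 h3]
    obtain ⟨N, hN, hNY⟩ : ∃ N : ℝ, 0 < N ∧ Y ≤ M + δ * Real.exp (N * (T' - t₁)) := by
      have hd : 0 < T' - t₁ := by linarith
      refine ⟨(|Y - M| / δ + 1) / (T' - t₁), by positivity, ?_⟩
      rw [div_mul_cancel₀ _ hd.ne']
      have := Real.add_one_le_exp (|Y - M| / δ + 1)
      have h1 : |Y - M| / δ ≤ Real.exp (|Y - M| / δ + 1) := by linarith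
      rw [div_le_iff₀ hδ] at h1
      have := le_abs_self (Y - M)
      linarith
    let φ : EuclideanSpace ℝ (Fin n) → ℝ → ℝ := fun x t =>
      (M + K * t + δ * Real.exp (N * (t - t₁))) + δ * Real.exp (‖x - z‖ ^ 2 + 2 * C * t)
    have hφc : Continuous fun p : EuclideanSpace ℝ (Fin n) × ℝ => φ p.1 p.2 := by
      simp only [φ]; fun_prop
    have hcomp : IsCompact (Metric.closedBall z R ×ˢ Icc 0 T') :=
      (isCompact_closedBall z R).prod isCompact_Icc
    have hsubs : Metric.closedBall z R ×ˢ Icc 0 T' ⊆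
        (univ : Set (EuclideanSpace ℝ (Fin n))) ×ˢ Ico 0 T := by
      rintro ⟨x, t⟩ ⟨-, ht⟩
      exact ⟨trivial, ht.1, ht.2.trans_lt hT2⟩
    have hmem : (x₁, t₁) ∈ Metric.closedBall z R ×ˢ Icc 0 T' :=
      ⟨by simpa [dist_eq_norm] using hRx, ht1pos.le, hT1.le⟩
    have husc' : UpperSemicontinuousOn (fun p => u p + -φ p.1 p.2)
        (Metric.closedBall z R ×ˢ Icc 0 T') :=
      (husc.mono hsubs).add hφc.neg.continuousOn.upperSemicontinuousOn
    obtain ⟨⟨x₀, t₀⟩, hp, hmax⟩ := husc'.exists_isMaxOn ⟨_, hmem⟩ hcomp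
    have hpos : φ x₀ t₀ < u (x₀, t₀) := by
      have h1 := hmax hmem
      simp only [mem_setOf_eq, φ, sub_self, mul_zero, Real.exp_zero, mul_one] at h1 ⊢
      linarith
    obtain ⟨hx₀, ht₀⟩ := hp
    simp only [Metric.mem_closedBall, dist_eq_norm] at hx₀
    simp only [mem_Icc] at ht₀
    have hKt : 0 ≤ K * t₀ := mul_nonneg hKnn ht₀.1
    have hE1 : 0 < δ * Real.exp (N * (t₀ - t₁)) := by positivity
    have hE2 : 0 < δ * Real.exp (‖x₀ - z‖ ^ 2 + 2 * C * t₀) := by positivity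
    simp only [φ] at hpos
    have ht0 : 0 < t₀ := by
      rcases ht₀.1.lt_or_eq with h1 | h1
      · exact h1
      · exfalso
        rw [← h1] at hpos hE1 hE2 hKt
        linarith [hinit x₀, hhM x₀]
    have htT : t₀ ∈ Ioo 0 T := ⟨ht0, ht₀.2.trans_lt hT2⟩
    have huY : u (x₀, t₀) ≤ Y := hR₀ R hRR₀ x₀ t₀ hx₀ htT
    have htT' : t₀ < T' := by
      rcases ht₀.2.lt_or_eq with h1 | h1
      · exact h1
      · exfalso
        rw [h1] at hpos hE1 hE2 hKt huY
        linarith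
    have hxR : ‖x₀ - z‖ < R := by
      rcases hx₀.lt_or_eq with h1 | h1
      · exact h1
      · exfalso
        rw [h1] at hpos
        have : Real.exp (R ^ 2) ≤ Real.exp (R ^ 2 + 2 * C * t₀) := by
          apply Real.exp_le_exp.mpr
          have : 0 ≤ 2 * C * t₀ := by positivity
          linarith
        rw [hYsq] at this
        have := mul_le_mul_of_nonneg_left this hδ.le
        linarith
    have hloc : IsLocalMaxOn (fun p => u p - φ p.1 p.2) (univ ×ˢ Ioo 0 T) (x₀, t₀) := by
      apply Filter.Eventually.filter_mono nhdsWithin_le_nhds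
      have hnb : Metric.ball z R ×ˢ Ioo 0 T' ∈ nhds (x₀, t₀) :=
        (Metric.isOpen_ball.prod isOpen_Ioo).mem_nhds
          ⟨by simpa [dist_eq_norm] using hxR, ht0, htT'⟩
      filter_upwards [hnb] with p hp
      have := hmax (show p ∈ _ from ⟨Metric.ball_subset_closedBall hp.1, Ioo_subset_Icc_self hp.2⟩)
      simpa [sub_eq_add_neg] using this
    have hfin := hsub φ
      (fun t => by
        simp only [φ]
        have : ContDiff ℝ 2 (fun x : EuclideanSpace ℝ (Fin n) => ‖x - z‖ ^ 2) :=
          (contDiff_id.sub contDiff_const).norm_sq ℝ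
        fun_prop)
      (fun x => by simp only [φ]; fun_prop) x₀ t₀ ⟨trivial, htT⟩ hloc
    have hb := hess_bound hn H hH C hC (M + K * t₀ + δ * Real.exp (N * (t₀ - t₁))) δ
      (2 * C * t₀) (Z (u (x₀, t₀))) hδ z x₀
    have hder : deriv (φ x₀) t₀ = K + δ * (Real.exp (N * (t₀ - t₁)) * N)
        + δ * (Real.exp (‖x₀ - z‖ ^ 2 + 2 * C * t₀) * (2 * C)) := by
      have hid := hasDerivAt_id t₀
      have h1 := ((((hid.sub_const t₁).const_mul N).exp).const_mul δ)
      have h2 := (((hid.const_mul (2 * C)).const_add (‖x₀ - z‖ ^ 2)).exp).const_mul δ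
      have h3 := (((hid.const_mul K).const_add M).add h1).add h2
      refine Eq.trans h3.deriv ?_
      simp
    have hχ' := (le_abs_self _).trans (hχK t₀ htT)
    rw [hder] at hfin
    simp only [φ] at hfin
    have : 0 < δ * (Real.exp (N * (t₀ - t₁)) * N) := by positivity
    nlinarith
  apply le_of_forall_pos_le_add
  intro ε hε
  have hE : 0 < 1 + Real.exp (‖x₁ - z‖ ^ 2 + 2 * C * t₁) := by positivity
  have h1 := main (ε / (1 + Real.exp (‖x₁ - z‖ ^ 2 + 2 * C * t₁))) (by positivity)
  have h2 : ε / (1 + Real.exp (‖x₁ - z‖ ^ 2 + 2 * C * t₁)) *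
    (1 + Real.exp (‖x₁ - z‖ ^ 2 + 2 * C * t₁)) = ε := div_mul_cancel₀ _ hE.ne'
  nlinarith
end
end

section
/- Maximum principle, case k=1, 0<σ≤1 (Theorem 2.9(b)): Suppose H satisfies Conditions A–C with k₁ = 0 (so k = 1, γ = 2; H(q,X) is then independent of q and is written H(X)) and Λ^sup < ∞. Let h : ℝⁿ → ℝ be continuous with sup_{ℝⁿ} h < ∞, let m ∈ ℝ, let Z : [m,∞) → [0,∞) be continuous and non-increasing, let χ : (0,T) → ℝ be bounded and continuous, and let 0 < σ ≤ 1. Let u be upper semicontinuous on ℝⁿ × [0,T) with inf u > m, a viscosity subsolution of H(D²u + Z(u)Du⊗Du) + χ(t)|Du|^σ − u_t = 0 in ℝⁿ_T, with u(x,0) ≤ h(x) for all x ∈ ℝⁿ. If sup_{B^R_T} u = e^{o(R)} as R → ∞, then there is a constant K ≥ 0, depending only on sup_{(0,T)}|χ(t)|, Λ^sup, σ and T, such that u(x,t) ≤ sup_{ℝⁿ} h + K(1−σ) for all (x,t) ∈ ℝⁿ_T. -/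
open Set MeasureTheory

noncomputable section

def bigF {n : ℕ} (z x : EuclideanSpace ℝ (Fin n)) : ℝ := Real.sqrt (1 + ‖x - z‖ ^ 2)

lemma bigF_pos {n : ℕ} (z x : EuclideanSpace ℝ (Fin n)) : 1 ≤ bigF z x := by
  unfold bigF
  rw [Real.one_le_sqrt]
  nlinarith [sq_nonneg ‖x - z‖]

lemma norm_le_bigF {n : ℕ} (z x : EuclideanSpace ℝ (Fin n)) : ‖x - z‖ ≤ bigF z x := by
  unfold bigF
  apply Real.le_sqrt_of_sq_le
  linarith

lemma bigF_contDiff {n : ℕ} (z : EuclideanSpace ℝ (Fin n)) : ContDiff ℝ 2 (bigF z) := by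
  unfold bigF
  apply ContDiff.sqrt
  · exact contDiff_const.add ((contDiff_id.sub contDiff_const).norm_sq ℝ)
  · intro x
    positivity

lemma bigF_hasFDerivAt {n : ℕ} (z x : EuclideanSpace ℝ (Fin n)) :
    HasFDerivAt (bigF z) ((1 / bigF z x) • innerSL ℝ (x - z)) x := by
  have h1 : HasFDerivAt (fun x : EuclideanSpace ℝ (Fin n) => 1 + ‖x - z‖ ^ 2)
      (2 • (innerSL ℝ (x - z))) x := by
    have := ((hasFDerivAt_id x).sub_const z).norm_sq.const_add 1
    exact this
  have h2 := h1.sqrt (by positivity)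
  refine HasFDerivAt.congr_fderiv (f := bigF z) h2 ?_
  ext v
  simp [bigF]
  ring

lemma comp_bigF {n : ℕ} (z x : EuclideanSpace ℝ (Fin n)) (g : ℝ → ℝ) (g' : ℝ)
    (hg : HasDerivAt g g' (bigF z x)) :
    HasFDerivAt (fun y => g (bigF z y)) ((g' / bigF z x) • innerSL ℝ (x - z)) x := by
  have := hg.comp_hasFDerivAt x (bigF_hasFDerivAt z x)
  refine HasFDerivAt.congr_fderiv this ?_
  rw [smul_smul]
  congr 1
  ring

lemma test_fderiv {n : ℕ} (z x : EuclideanSpace ℝ (Fin n)) (c k : ℝ) :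
    HasFDerivAt (fun y => c + k * Real.exp (bigF z y))
      ((k * Real.exp (bigF z x) / bigF z x) • innerSL ℝ (x - z)) x := by
  apply comp_bigF z x (fun s => c + k * Real.exp s)
  exact ((Real.hasDerivAt_exp _).const_mul k).const_add c

lemma test_grad {n : ℕ} (z x : EuclideanSpace ℝ (Fin n)) (c k : ℝ) :
    spaceGrad (fun y => c + k * Real.exp (bigF z y)) x =
      (k * Real.exp (bigF z x) / bigF z x) • (x - z) := by
  unfold spaceGrad
  rw [(test_fderiv z x c k).fderiv]
  ext i
  simp [EuclideanSpace.inner_single_right]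

lemma test_hess {n : ℕ} (z x : EuclideanSpace ℝ (Fin n)) (c k : ℝ) :
    ∃ μ : ℝ, spaceHess (fun y => c + k * Real.exp (bigF z y)) x =
      (k * Real.exp (bigF z x) / bigF z x) • (1 : Matrix (Fin n) (Fin n) ℝ)
        + μ • outerProd (x - z) := by
  have hS : bigF z x ≠ 0 := by linarith [bigF_pos z x]
  obtain ⟨g', hg⟩ : ∃ g', HasDerivAt (fun s => k * Real.exp s / s) g' (bigF z x) :=
    ⟨_, ((Real.hasDerivAt_exp (bigF z x)).const_mul k).div (hasDerivAt_id (bigF z x)) hS⟩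
  have h1 := comp_bigF z x _ _ hg
  refine ⟨g' / bigF z x, ?_⟩
  unfold spaceHess
  ext i j
  have e : (fun y => fderiv ℝ (fun y => c + k * Real.exp (bigF z y)) y
      (EuclideanSpace.single j 1)) =
      fun y => (k * Real.exp (bigF z y) / bigF z y) * inner ℝ (y - z) (EuclideanSpace.single j (1:ℝ)) := by
    funext y
    rw [(test_fderiv z y c k).fderiv]
    rfl
  have h2 : HasFDerivAt (fun y : EuclideanSpace ℝ (Fin n) => inner ℝ (y - z) (EuclideanSpace.single j (1:ℝ)))
      (innerSL ℝ (EuclideanSpace.single j (1:ℝ))) x := by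
    have := (innerSL ℝ (EuclideanSpace.single j (1:ℝ))).hasFDerivAt.comp x ((hasFDerivAt_id x).sub_const z)
    refine HasFDerivAt.congr_of_eventuallyEq this (Filter.Eventually.of_forall fun y => ?_)
    exact real_inner_comm _ _
  have h3 := h1.mul h2
  simp only [Matrix.of_apply]
  rw [e]
  erw [h3.fderiv]
  simp [outerProd, Matrix.one_apply, EuclideanSpace.inner_single_right, EuclideanSpace.inner_single_left]
  ring

lemma H_bound_s5 {n : ℕ} (hn : 2 ≤ n)
    (H : EuclideanSpace ℝ (Fin n) → Matrix (Fin n) (Fin n) ℝ → ℝ) (hH : ConditionsABC n H 0)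
    (L : ℝ) (hL : ∀ (lam : ℝ) (e : EuclideanSpace ℝ (Fin n)), ‖e‖ = 1 →
      H e (lam • outerProd e + 1) ≤ L) (p μ : ℝ) (hp : 0 < p) (y : EuclideanSpace ℝ (Fin n)) :
    H 0 (p • (1 : Matrix (Fin n) (Fin n) ℝ) + μ • outerProd y) ≤ p * L := by
  have h0 : ∀ q X, H 0 X = H q X := by
    intro q X
    have := hH.hom_q 0 q X
    simpa using this
  by_cases hy : y = 0
  · let e : EuclideanSpace ℝ (Fin n) := EuclideanSpace.single ⟨0, by omega⟩ 1
    have he : ‖e‖ = 1 := by simp [e]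
    have := hL 0 e he
    rw [h0 e]
    have e2 : p • (1 : Matrix (Fin n) (Fin n) ℝ) + μ • outerProd y
        = p • ((0:ℝ) • outerProd e + 1) := by
      subst hy
      ext i j
      simp [outerProd]
    rw [e2, hH.hom_X p hp]
    gcongr
  · have hy' : ‖y‖ ≠ 0 := by simpa using hy
    let e : EuclideanSpace ℝ (Fin n) := (‖y‖⁻¹) • y
    have he : ‖e‖ = 1 := by simp [e, norm_smul, hy']
    have := hL (μ * ‖y‖ ^ 2 / p) e he
    rw [h0 e]
    have e2 : p • (1 : Matrix (Fin n) (Fin n) ℝ) + μ • outerProd y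
        = p • ((μ * ‖y‖ ^ 2 / p) • outerProd e + 1) := by
      ext i j
      simp [outerProd, e]
      field_simp
      ring
    rw [e2, hH.hom_X p hp]
    gcongr

lemma rpow_young (q σ : ℝ) (hq : 0 ≤ q) (h0 : 0 < σ) (h1 : σ ≤ 1) :
    q ^ σ ≤ q + (1 - σ) := by
  have := Real.geom_mean_le_arith_mean2_weighted h0.le (sub_nonneg.2 h1) hq zero_le_one (by ring)
  simp at this
  nlinarith

set_option maxHeartbeats 1000000 in
lemma core {n : ℕ} (hn : 2 ≤ n)
    (H : EuclideanSpace ℝ (Fin n) → Matrix (Fin n) (Fin n) ℝ → ℝ) (hH : ConditionsABC n H 0)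
    (L : ℝ) (hL : ∀ (lam : ℝ) (e : EuclideanSpace ℝ (Fin n)), ‖e‖ = 1 →
      H e (lam • outerProd e + 1) ≤ L) (hL0 : 0 ≤ L) (T A : ℝ)
    (Z χ : ℝ → ℝ) (α : ℝ) (hα0 : 0 ≤ α) (hα : ∀ t ∈ Ioo 0 T, |χ t| ≤ α)
    (σ : ℝ) (hσ : 0 < σ) (hσ1 : σ ≤ 1)
    (u : EuclideanSpace ℝ (Fin n) × ℝ → ℝ)
    (hu : UpperSemicontinuousOn u (univ ×ˢ Ico 0 T))
    (hsub : ParabolicSubsolution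
        (fun t r q X pt => H 0 (X + Z r • outerProd q) + χ t * ‖q‖ ^ σ - pt)
        (univ ×ˢ Ioo 0 T) u)
    (hA : ∀ x, u (x, 0) ≤ A) (z : EuclideanSpace ℝ (Fin n))
    (R₀ : ℝ) (hR : ∀ R ≥ R₀, ∀ (x : EuclideanSpace ℝ (Fin n)) (t : ℝ),
        ‖x - z‖ ≤ R → t ∈ Ioo 0 T → u (x, t) ≤ Real.exp ((1/2) * R))
    (x₀ : EuclideanSpace ℝ (Fin n)) (t₀ : ℝ) (ht₀ : t₀ ∈ Ioo 0 T) :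
    u (x₀, t₀) ≤ A + α * (1 - σ) * t₀ := by
  by_contra! hcon
  obtain ⟨ht0, htT⟩ := ht₀
  set gap := u (x₀, t₀) - (A + α * (1 - σ) * t₀) with hgap
  have hgap0 : 0 < gap := by linarith
  set C := L + α with hC
  have hC0 : 0 ≤ C := by positivity
  set η := gap / 2 with hη
  have hη0 : 0 < η := by positivity
  set δ := gap / 4 / (Real.exp (C * t₀) * Real.exp (bigF z x₀)) with hδ
  have hδ0 : 0 < δ := by positivity
  set T₂ := (t₀ + T) / 2 with hT2
  have hT2a : t₀ < T₂ := by linarith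
  have hT2b : T₂ < T := by linarith
  -- choice of radius
  obtain ⟨R₁, hR1a, hR1b, hR1c⟩ : ∃ R₁ : ℝ, R₀ ≤ R₁ ∧ ‖x₀ - z‖ < R₁ ∧
      Real.exp ((1/2) * R₁) < A + δ * Real.exp R₁ := by
    have h1 : Filter.Tendsto (fun R : ℝ => Real.exp ((1/2) * R)) Filter.atTop Filter.atTop :=
      Real.tendsto_exp_atTop.comp (Filter.tendsto_id.const_mul_atTop (by norm_num))
    have h2 := h1.eventually_gt_atTop ((1 + |A|) / δ + 1)
    obtain ⟨R₁, ha, hb, hc⟩ := ((Filter.eventually_ge_atTop R₀).and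
      ((Filter.eventually_gt_atTop ‖x₀ - z‖).and h2)).exists
    refine ⟨R₁, ha, hb, ?_⟩
    have e : Real.exp R₁ = Real.exp ((1/2) * R₁) * Real.exp ((1/2) * R₁) := by
      rw [← Real.exp_add]; ring_nf
    rw [e]
    set E := Real.exp ((1/2) * R₁)
    have hE1 : 1 < E := by
      have : 0 ≤ (1 + |A|) / δ := by positivity
      linarith
    have hE2 : 1 + |A| < δ * E := by
      have : (1 + |A|) / δ < E := by linarith
      rw [div_lt_iff₀ hδ0] at this
      linarith
    have := neg_abs_le A
    nlinarith [abs_nonneg A]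
  set B := Real.exp ((1/2) * R₁) - A with hB
  set N := (|B| + 1) / (η * (T₂ - t₀)) with hN
  have hd : 0 < T₂ - t₀ := by linarith
  have hN0 : 0 < N := by positivity
  have hNB : B < η * Real.exp (N * (T₂ - t₀)) := by
    have h1 := Real.add_one_le_exp (N * (T₂ - t₀))
    have h2 : η * (N * (T₂ - t₀)) = |B| + 1 := by
      rw [hN]; field_simp
    have := le_abs_self B
    nlinarith
  let φ : EuclideanSpace ℝ (Fin n) → ℝ → ℝ := fun x t =>
    (A + α * (1 - σ) * t + η * Real.exp (N * (t - t₀))) +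
      (δ * Real.exp (C * t)) * Real.exp (bigF z x)
  have hbc : Continuous (bigF z) := (bigF_contDiff z).continuous
  have hφc : Continuous (fun p : EuclideanSpace ℝ (Fin n) × ℝ => φ p.1 p.2) := by
    have : Continuous (fun p : EuclideanSpace ℝ (Fin n) × ℝ => bigF z p.1) := hbc.comp continuous_fst
    simp only [φ]
    fun_prop
  set K := Metric.closedBall z R₁ ×ˢ Icc 0 T₂ with hK
  have hKc : IsCompact K := (isCompact_closedBall z R₁).prod isCompact_Icc
  have hx0K : (x₀, t₀) ∈ K := by
    refine ⟨?_, ht0.le, hT2a.le⟩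
    simp only [Metric.mem_closedBall, dist_eq_norm]
    exact hR1b.le
  have husc : UpperSemicontinuousOn (fun p => u p - φ p.1 p.2) K := by
    have h1 : UpperSemicontinuousOn u K := hu.mono (by
      rintro ⟨x, t⟩ ⟨_, h⟩
      exact ⟨mem_univ _, h.1, lt_of_le_of_lt h.2 hT2b⟩)
    have h2 := h1.add (hφc.neg.upperSemicontinuous.upperSemicontinuousOn K)
    simpa [sub_eq_add_neg] using h2
  obtain ⟨⟨x₁, t₁⟩, hp, hmax⟩ := husc.exists_isMaxOn ⟨_, hx0K⟩ hKc
  have hpos : 0 < u (x₁, t₁) - φ x₁ t₁ := by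
    have h1 := hmax hx0K
    simp only [mem_ofPred_eq] at h1
    have h2 : φ x₀ t₀ = A + α * (1 - σ) * t₀ + η + gap / 4 := by
      simp only [φ, sub_self, mul_zero, Real.exp_zero, mul_one, hδ]
      field_simp
    have h3 : u (x₀, t₀) = gap + (A + α * (1 - σ) * t₀) := by rw [hgap]; ring
    linarith
  obtain ⟨hx1, ht1a, ht1b⟩ := hp
  simp only [Metric.mem_closedBall, dist_eq_norm] at hx1 ht1a ht1b
  have hσα : 0 ≤ α * (1 - σ) := mul_nonneg hα0 (by linarith)
  have hterm : 0 ≤ α * (1 - σ) * t₁ := mul_nonneg hσα ht1a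
  have hη1 : 0 < η * Real.exp (N * (t₁ - t₀)) := by positivity
  have hδ1 : δ * Real.exp (bigF z x₁) ≤ δ * Real.exp (C * t₁) * Real.exp (bigF z x₁) := by
    have : 1 ≤ Real.exp (C * t₁) := Real.one_le_exp (by positivity)
    have h2 : 0 < δ * Real.exp (bigF z x₁) := by positivity
    nlinarith
  have hδ2 : 0 < δ * Real.exp (bigF z x₁) := by positivity
  have hφ1 : φ x₁ t₁ = (A + α * (1 - σ) * t₁ + η * Real.exp (N * (t₁ - t₀))) +
      (δ * Real.exp (C * t₁)) * Real.exp (bigF z x₁) := rfl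
  have ht1pos : 0 < t₁ := by
    rcases ht1a.lt_or_eq with h | h
    · exact h
    · exfalso
      have := hA x₁
      rw [← h] at hpos hφ1 hterm hη1 hδ1
      linarith
  have ht1T : t₁ ∈ Ioo 0 T := ⟨ht1pos, lt_of_le_of_lt ht1b hT2b⟩
  have hub := hR R₁ hR1a x₁ t₁ hx1 ht1T
  have ht1lt : t₁ < T₂ := by
    rcases ht1b.lt_or_eq with h | h
    · exact h
    · exfalso
      rw [h] at hub hpos hφ1 hterm hη1 hδ1
      linarith
  have hx1lt : ‖x₁ - z‖ < R₁ := by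
    rcases hx1.lt_or_eq with h | h
    · exact h
    · exfalso
      have h1 := norm_le_bigF z x₁
      rw [h] at h1
      have h2 : δ * Real.exp R₁ ≤ δ * Real.exp (bigF z x₁) := by gcongr
      linarith
  have hloc : IsLocalMaxOn (fun p => u p - φ p.1 p.2) (univ ×ˢ Ioo 0 T) (x₁, t₁) := by
    apply Filter.Eventually.filter_mono nhdsWithin_le_nhds
    have : K ∈ nhds (x₁, t₁) := by
      apply prod_mem_nhds
      · apply Filter.mem_of_superset (Metric.isOpen_ball.mem_nhds (x := x₁) ?_)
          Metric.ball_subset_closedBall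
        simpa [dist_eq_norm] using hx1lt
      · exact Icc_mem_nhds ht1pos ht1lt
    filter_upwards [this] with p hp
    exact hmax hp
  have key := hsub φ
    (fun t => contDiff_const.add (contDiff_const.mul (bigF_contDiff z).exp))
    (fun x => by simp only [φ]; fun_prop) x₁ t₁ ⟨mem_univ _, ht1T⟩ hloc
  have hder : deriv (φ x₁) t₁ = α * (1 - σ) + η * (N * Real.exp (N * (t₁ - t₀)))
      + δ * (C * Real.exp (C * t₁)) * Real.exp (bigF z x₁) := by
    apply HasDerivAt.deriv
    have h1 : HasDerivAt (fun t => N * (t - t₀)) N t₁ := by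
      simpa using ((hasDerivAt_id t₁).sub_const t₀).const_mul N
    have h2 : HasDerivAt (fun t => C * t) C t₁ := by
      simpa using (hasDerivAt_id t₁).const_mul C
    have h3 : HasDerivAt (fun t => A + α * (1 - σ) * t) (α * (1 - σ)) t₁ := by
      simpa using ((hasDerivAt_id t₁).const_mul (α * (1 - σ))).const_add A
    have := (h3.add (h1.exp.const_mul η)).add
      ((h2.exp.const_mul δ).mul_const (Real.exp (bigF z x₁)))
    refine HasDerivAt.congr_deriv (f := φ x₁) this ?_
    ring
  clear_value gap
  set k := δ * Real.exp (C * t₁) with hk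
  have hk0 : 0 < k := by positivity
  have hgrad : spaceGrad (fun x => φ x t₁) x₁ = _ :=
    test_grad z x₁ (A + α * (1 - σ) * t₁ + η * Real.exp (N * (t₁ - t₀))) k
  obtain ⟨μ, hμ⟩ := test_hess z x₁ (A + α * (1 - σ) * t₁ + η * Real.exp (N * (t₁ - t₀))) k
  have hhess : spaceHess (fun x => φ x t₁) x₁ = _ := hμ
  have hS1 := bigF_pos z x₁
  set p := k * Real.exp (bigF z x₁) / bigF z x₁ with hpdef
  have hp0 : 0 < p := by
    have : 0 < bigF z x₁ := by linarith
    positivity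
  have hple : p ≤ k * Real.exp (bigF z x₁) := div_le_self (by positivity) hS1
  have hpn : ‖p • (x₁ - z)‖ ≤ k * Real.exp (bigF z x₁) := by
    rw [norm_smul, Real.norm_of_nonneg hp0.le]
    calc p * ‖x₁ - z‖ ≤ p * bigF z x₁ := by gcongr; exact norm_le_bigF z x₁
      _ = _ := by rw [hpdef]; field_simp
  simp only at key
  rw [hgrad, hhess, hder] at key
  have hout : outerProd (p • (x₁ - z)) = p ^ 2 • outerProd (x₁ - z) := by
    ext i j
    simp [outerProd]
    ring
  rw [hout, smul_smul, add_assoc, ← add_smul] at key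
  have hHb := H_bound_s5 hn H hH L hL p (μ + Z (u (x₁, t₁)) * p ^ 2) hp0 (x₁ - z)
  have hpL : p * L ≤ k * Real.exp (bigF z x₁) * L := by gcongr
  have hy := rpow_young ‖p • (x₁ - z)‖ σ (norm_nonneg _) hσ hσ1
  have hχ : χ t₁ * ‖p • (x₁ - z)‖ ^ σ ≤ α * (k * Real.exp (bigF z x₁) + (1 - σ)) := by
    have h1 : χ t₁ ≤ α := (le_abs_self _).trans (hα _ ht1T)
    calc χ t₁ * ‖p • (x₁ - z)‖ ^ σ ≤ α * ‖p • (x₁ - z)‖ ^ σ := by gcongr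
      _ ≤ _ := by gcongr; linarith
  have hlast : 0 < η * (N * Real.exp (N * (t₁ - t₀))) := by positivity
  have hCk : δ * (C * Real.exp (C * t₁)) * Real.exp (bigF z x₁)
      = L * (k * Real.exp (bigF z x₁)) + α * (k * Real.exp (bigF z x₁)) := by
    rw [hk, hC]; ring
  linarith [mul_add α (k * Real.exp (bigF z x₁)) (1 - σ)]

/-- **Theorem 2.9(b)** (maximum principle, `k = 1`, `0 < σ ≤ 1`).
Since `k₁ = 0`, `H(q,X)` is independent of `q` and we write `H(X) = H(0,X)`.
The constant `K ≥ 0` depends only on `α = sup_{(0,T)}|χ|`, `Λ^sup`, `σ` and `T`;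
this is expressed by quantifying the function `K` before all the data. -/
theorem maximum_principle_k_eq_one_sigma_le_one :
    ∃ K : ℝ → ℝ → ℝ → ℝ → ℝ, (∀ a b c d, 0 ≤ K a b c d) ∧
      ∀ (n : ℕ), 2 ≤ n →
      ∀ (H : EuclideanSpace ℝ (Fin n) → Matrix (Fin n) (Fin n) ℝ → ℝ),
      ConditionsABC n H 0 →
      LambdaSupFinite n H →
      ∀ (T : ℝ), 0 < T →
      ∀ (h : EuclideanSpace ℝ (Fin n) → ℝ), Continuous h →
      BddAbove (Set.range h) →
      ∀ (m : ℝ) (Z : ℝ → ℝ),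
      ContinuousOn Z (Ici m) → AntitoneOn Z (Ici m) → (∀ s ∈ Ici m, 0 ≤ Z s) →
      ∀ (χ : ℝ → ℝ), ContinuousOn χ (Ioo 0 T) →
      BddAbove ((fun t => |χ t|) '' Ioo 0 T) →
      ∀ (σ : ℝ), 0 < σ → σ ≤ 1 →
      ∀ (u : EuclideanSpace ℝ (Fin n) × ℝ → ℝ),
      UpperSemicontinuousOn u (univ ×ˢ Ico 0 T) →
      (∃ c, m < c ∧ ∀ (x : EuclideanSpace ℝ (Fin n)), ∀ t ∈ Ico 0 T, c ≤ u (x, t)) →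
      ParabolicSubsolution
        (fun t r q X pt => H 0 (X + Z r • outerProd q) + χ t * ‖q‖ ^ σ - pt)
        (univ ×ˢ Ioo 0 T) u →
      (∀ x, u (x, 0) ≤ h x) →
      ∀ (z : EuclideanSpace ℝ (Fin n)),
      (∀ ε > (0:ℝ), ∃ R₀ : ℝ, ∀ R ≥ R₀, ∀ (x : EuclideanSpace ℝ (Fin n)) (t : ℝ),
        ‖x - z‖ ≤ R → t ∈ Ioo 0 T → u (x, t) ≤ Real.exp (ε * R)) →
      ∀ (x : EuclideanSpace ℝ (Fin n)), ∀ t ∈ Ioo 0 T,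
        u (x, t) ≤ (⨆ y, h y) +
          K (sSup ((fun s => |χ s|) '' Ioo 0 T))
            (sSup {y : ℝ | ∃ (lam : ℝ) (e : EuclideanSpace ℝ (Fin n)),
              ‖e‖ = 1 ∧ y = H e (lam • outerProd e + 1)})
            σ T * (1 - σ) := by
  refine ⟨fun a _ _ d => |a| * |d|, fun a b c d => by positivity, ?_⟩
  intro n hn H hH hΛ T hT h _ hhb m Z _ _ _ χ _ hχb σ hσ hσ1 u hu _ hsub hu0 z hgr x t ht
  set α := sSup ((fun s => |χ s|) '' Ioo 0 T) with hαdef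
  have hα : ∀ t ∈ Ioo 0 T, |χ t| ≤ α := fun s hs => le_csSup hχb (mem_image_of_mem _ hs)
  have hα0 : 0 ≤ α := (abs_nonneg _).trans (hα t ht)
  obtain ⟨L, hL⟩ := hΛ
  obtain ⟨R₀, hR⟩ := hgr (1/2) (by norm_num)
  have h1 := core hn H hH (max L 0) (fun lam e he => (hL lam e he).trans (le_max_left _ _))
    (le_max_right _ _) T (⨆ y, h y) Z χ α hα0 hα σ hσ hσ1 u hu hsub
    (fun x => (hu0 x).trans (le_ciSup hhb x)) z R₀ hR x t ht
  refine h1.trans ?_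
  simp only [abs_of_nonneg hα0, abs_of_pos hT]
  have h2 : 0 ≤ α * (1 - σ) := mul_nonneg hα0 (by linarith)
  nlinarith [ht.2]
end
end
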